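/- With the reflected–tiled extension setup (0 < η < 1, R = 2^k r with Rη/2 < r ≤ Rη, φ: Q_{2R} → ℝ Lip(1,1/2) with constant ℓ, φ(0,0) = 0, φ̃ the reflected–tiled extension), assume ‖∇φ‖_{*,Q_{2R}} ≤ C₀η. Let ρ: ℝ^{n−1} → [0,1] be smooth with ρ = 1 on {|x|_∞ < r}, ρ = 0 on {|x|_∞ > 2R}, |∇ρ| ≤ C₀/R and |∇²ρ| ≤ C₀/R², and define Φ: ℝ^{n−1}×ℝ → ℝ by Φ = φ̃ρ + (1−ρ)(x·(∇φ̃)_{Q_r}), where (∇φ̃)_{Q_r} is the average of the spatial gradient of φ̃ over Q_r. Then ∇Φ belongs to parabolic BMO(ℝⁿ) and for every 0 < ε < 1, ‖∇Φ‖_* ≤ C_ε(η^{1−ε} + ηℓ), with C_ε depending only on n, C₀ and ε. -/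

import Mathlib

open MeasureTheory Set
open scoped ENNReal NNReal RealInnerProductSpace

noncomputable section

/-- `ℝ^m` with the Euclidean norm. -/
abbrev E (m : ℕ) := EuclideanSpace ℝ (Fin m)

namespace Par

/-- Parabolic distance on `ℝ^m × ℝ`. -/
def pdist {m : ℕ} (p q : E m × ℝ) : ℝ := ‖p.1 - q.1‖ + Real.sqrt |p.2 - q.2|

/-- Parabolic norm `‖(x,t)‖ = |x| + |t|^{1/2}`. -/
def pnorm {m : ℕ} (p : E m × ℝ) : ℝ := ‖p.1‖ + Real.sqrt |p.2|

/-- Parabolic ball. -/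
def pball {m : ℕ} (c : E m × ℝ) (r : ℝ) : Set (E m × ℝ) := {p | pdist c p < r}

/-- Parabolic cube `Q_r(c)`. -/
def pcube {m : ℕ} (c : E m × ℝ) (r : ℝ) : Set (E m × ℝ) :=
  {p | (∀ i, |p.1 i - c.1 i| < r) ∧ Real.sqrt |p.2 - c.2| < r}

/-- Parabolic distance to the boundary of `Ω`. -/
def distBd {m : ℕ} (Ω : Set (E m × ℝ)) (p : E m × ℝ) : ℝ :=
  sInf (pdist p '' frontier Ω)

/-- Parabolic diameter of a set. -/
def pdiam {m : ℕ} (S : Set (E m × ℝ)) : ℝ :=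
  sSup ((fun q : (E m × ℝ) × (E m × ℝ) => pdist q.1 q.2) '' (S ×ˢ S))

/-- `φ` is `Lip(1,1/2)` with constant `ℓ` on `S`. -/
def LipPar {m : ℕ} (φ : E m × ℝ → ℝ) (ℓ : ℝ) (S : Set (E m × ℝ)) : Prop :=
  ∀ p ∈ S, ∀ q ∈ S, |φ p - φ q| ≤ ℓ * pdist p q

/-- `g` is the a.e. (spatial) gradient of `φ` on `S`. -/
def IsSpatialGradientOn {m : ℕ} (φ : E m × ℝ → ℝ) (g : E m × ℝ → E m)
    (S : Set (E m × ℝ)) : Prop :=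
  ∀ᵐ p ∂(volume.restrict S), HasGradientAt (fun x => φ (x, p.2)) (g p) p.1

/-- Parabolic BMO bound for `f` on `S`: every parabolic cube contained in `S`
has mean oscillation at most `B`. -/
def BMOleOn {m : ℕ} {V : Type*} [NormedAddCommGroup V] [NormedSpace ℝ V]
    (f : E m × ℝ → V) (S : Set (E m × ℝ)) (B : ℝ) : Prop :=
  ∀ c r, 0 < r → pcube c r ⊆ S →
    ⨍ p in pcube c r, ‖f p - ⨍ q in pcube c r, f q‖ ≤ B

/-- The quantity `|Q_s|⁻¹ ∫_{Q_s} ∫_{I_s} |φ(x,t) − φ(x,τ)|²/|t−τ|² dτ dt dx`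
for the parabolic cube `Q_s = J_s × I_s` centred at `c`. -/
def timeDiffSq {m : ℕ} (φ : E m × ℝ → ℝ) (c : E m × ℝ) (s : ℝ) : ℝ :=
  (volume (pcube c s)).toReal⁻¹ *
    ∫ p in pcube c s, ∫ τ in Set.Ioo (c.2 - s^2) (c.2 + s^2),
      (φ p - φ (p.1, τ))^2 / (p.2 - τ)^2

/-- The spatial direction `e_i` in `ℝ^n × ℝ`. -/
def spDir {n : ℕ} (i : Fin n) : E n × ℝ := (EuclideanSpace.single i 1, 0)

/-- The time direction in `ℝ^n × ℝ`. -/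
def tDir {n : ℕ} : E n × ℝ := (0, 1)

/-- `u` (with spatial weak gradient `du`) is a weak solution of
`u_t = div(A ∇u) + B·∇u` in `Ω`. -/
structure WeakSolution {n : ℕ} (Ω : Set (E n × ℝ))
    (A : E n × ℝ → Fin n → Fin n → ℝ) (B : E n × ℝ → E n)
    (u : E n × ℝ → ℝ) (du : E n × ℝ → E n) : Prop where
  u_loc : ∀ K, K ⊆ Ω → IsCompact K → IntegrableOn (fun p => (u p)^2) K volume
  du_loc : ∀ K, K ⊆ Ω → IsCompact K → IntegrableOn (fun p => ‖du p‖^2) K volume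
  sup_slice : ∀ K : Set (E n), IsCompact K → ∃ M : ℝ, ∀ t : ℝ,
    ∫ X in {X | (X, t) ∈ Ω} ∩ K, (u (X, t))^2 ≤ M
  weak_grad : ∀ ψ : E n × ℝ → ℝ, ContDiff ℝ (⊤ : ℕ∞) ψ → HasCompactSupport ψ →
    tsupport ψ ⊆ Ω → ∀ i : Fin n,
    ∫ p in Ω, u p * fderiv ℝ ψ p (spDir i) = - ∫ p in Ω, du p i * ψ p
  weak_pde : ∀ ψ : E n × ℝ → ℝ, ContDiff ℝ (⊤ : ℕ∞) ψ → HasCompactSupport ψ →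
    tsupport ψ ⊆ Ω →
    ∫ p in Ω, (- u p * fderiv ℝ ψ p tDir
      + ∑ i, ∑ j, A p i j * du p j * fderiv ℝ ψ p (spDir i)
      - ψ p * ∑ i, B p i * du p i) = 0

/-- Uniform ellipticity (a.e. on `Ω`) with constants `lam ≤ Lam`. -/
def UniformlyElliptic {n : ℕ} (Ω : Set (E n × ℝ))
    (A : E n × ℝ → Fin n → Fin n → ℝ) (lam Lam : ℝ) : Prop :=
  ∀ᵐ p ∂(volume.restrict Ω), ∀ ξ : E n,
    lam * ‖ξ‖^2 ≤ ∑ i, ∑ j, A p i j * ξ i * ξ j ∧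
      ∑ i, ∑ j, A p i j * ξ i * ξ j ≤ Lam * ‖ξ‖^2

/-- Bounded measurable matrix coefficients. -/
def BoundedMeasurableCoeff {n : ℕ} (A : E n × ℝ → Fin n → Fin n → ℝ) : Prop :=
  (∀ i j, Measurable fun p => A p i j) ∧ ∃ M : ℝ, ∀ p i j, |A p i j| ≤ M

/-- The `p`-adapted weight `|∇u|²|u|^{p−2}`, with the convention that it
vanishes wherever `∇u` does (`0^{p-2} = ∞` in `ℝ≥0∞` otherwise). -/
def sqW (p : ℝ) (uv gv : ℝ) : ℝ≥0∞ :=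
  if gv = 0 then 0 else (ENNReal.ofReal |gv|) ^ 2 * (ENNReal.ofReal |uv|) ^ (p - 2)

end Par

namespace Par

/-- The reflected–tiled reparametrisation of time: period `4r²`, identity on
`[−r², r²]`, reflection `t ↦ 2r² − t` on `[r², 3r²]`. -/
def tileT (r t : ℝ) : ℝ :=
  let k : ℤ := ⌊(t + r ^ 2) / (4 * r ^ 2)⌋
  let s : ℝ := t - 4 * k * r ^ 2
  if s ≤ r ^ 2 then s else 2 * r ^ 2 - s

/-- The reflected–tiled extension in time of `φ`. -/
def tRef {m : ℕ} (r : ℝ) (φ : E m × ℝ → ℝ) (p : E m × ℝ) : ℝ :=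
  φ (p.1, tileT r p.2)

/-- The reflected–tiled extension in time of a vector-valued function
(e.g. the spatial gradient `∇φ`). -/
def tRefV {m : ℕ} (r : ℝ) (g : E m × ℝ → E m) (p : E m × ℝ) : E m :=
  g (p.1, tileT r p.2)

/-- A parabolic cube of radius `2^z · r` from the dyadic grid generated by the
parabolic cube `Q_r` centred at the origin. -/
def dyadicCube (m : ℕ) (r : ℝ) (z : ℤ) (k : Fin m → ℤ) (j : ℤ) : Set (E m × ℝ) :=
  {p | (∀ i, p.1 i ∈ Set.Ico (2 * ((2:ℝ)^z * r) * k i - r)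
          (2 * ((2:ℝ)^z * r) * k i + 2 * ((2:ℝ)^z * r) - r)) ∧
    p.2 ∈ Set.Ico (2 * ((2:ℝ)^z * r)^2 * j - r^2)
          (2 * ((2:ℝ)^z * r)^2 * j + 2 * ((2:ℝ)^z * r)^2 - r^2)}

/-- A modulus of continuity. -/
def IsModulus (δ : ℝ → ℝ) : Prop := δ 0 = 0 ∧ ContinuousAt δ 0 ∧ ∀ s, 0 ≤ δ s

end Par

open Par

namespace Par

variable {m : ℕ}

lemma norm_le_of_coord_le {x : E m} {a : ℝ} (ha : 0 ≤ a) (h : ∀ i, |x i| ≤ a) :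
    ‖x‖ ≤ m * a := by
  rw [EuclideanSpace.norm_eq]
  apply Real.sqrt_le_iff.2 ⟨by positivity, ?_⟩
  calc ∑ i, ‖x i‖ ^ 2 ≤ ∑ _i : Fin m, a ^ 2 := by
        refine Finset.sum_le_sum fun i _ => ?_
        have := h i
        rw [Real.norm_eq_abs]
        gcongr
    _ = (m : ℝ) * a ^ 2 := by simp
    _ ≤ (m : ℝ) ^ 2 * a ^ 2 := by
        gcongr
        exact_mod_cast Nat.le_self_pow two_ne_zero m
    _ = (m * a) ^ 2 := by ring

lemma mem_pcube_iff {c p : E m × ℝ} {r : ℝ} (hr : 0 < r) :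
    p ∈ pcube c r ↔ (∀ i, |p.1 i - c.1 i| < r) ∧ |p.2 - c.2| < r ^ 2 := by
  simp only [pcube, mem_ofPred_eq, Real.sqrt_lt' hr]

/-- The open box of radius `r` in `ℝ^m`. -/
def box (a : E m) (r : ℝ) : Set (E m) := {x | ∀ i, |x i - a i| < r}

lemma pcube_eq_prod (c : E m × ℝ) {r : ℝ} (hr : 0 < r) :
    pcube c r = box c.1 r ×ˢ Ioo (c.2 - r ^ 2) (c.2 + r ^ 2) := by
  ext p
  rw [mem_pcube_iff hr, mem_prod, mem_Ioo, abs_lt, box, mem_ofPred_eq]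
  constructor <;> rintro ⟨h1, h2, h3⟩ <;> exact ⟨h1, by linarith, by linarith⟩

lemma isOpen_box (a : E m) (r : ℝ) : IsOpen (box a r) := by
  simp only [box, ofPred_forall]
  refine isOpen_iInter_of_finite fun i => ?_
  exact isOpen_lt (by fun_prop) continuous_const

lemma isOpen_pcube (c : E m × ℝ) {r : ℝ} (hr : 0 < r) : IsOpen (pcube c r) := by
  rw [pcube_eq_prod c hr]
  exact (isOpen_box _ _).prod isOpen_Ioo

lemma measurableSet_pcube (c : E m × ℝ) {r : ℝ} (hr : 0 < r) : MeasurableSet (pcube c r) :=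
  (isOpen_pcube c hr).measurableSet

lemma volume_pi_preimage (s : Fin m → Set ℝ) (hs : ∀ i, MeasurableSet (s i)) :
    volume {x : E m | ∀ i, x i ∈ s i} = ∏ i, volume (s i) := by
  rw [← volume_pi_pi, ← (EuclideanSpace.volume_preserving_symm_measurableEquiv_toLp
    (Fin m)).measure_preimage (MeasurableSet.univ_pi hs).nullMeasurableSet]
  congr 1
  ext x
  simp

lemma volume_box (a : E m) (r : ℝ) : volume (box a r) = ENNReal.ofReal (2 * r) ^ m := by
  have : box a r = {x : E m | ∀ i, x i ∈ Ioo (a i - r) (a i + r)} := by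
    ext x
    simp only [box, mem_ofPred_eq, mem_Ioo, abs_lt]
    refine forall_congr' fun i => ?_
    constructor <;> rintro ⟨h1, h2⟩ <;> constructor <;> linarith
  rw [this, volume_pi_preimage _ fun i => measurableSet_Ioo]
  simp only [Real.volume_Ioo]
  rw [Finset.prod_congr rfl fun i _ => by rw [show a i + r - (a i - r) = 2 * r by ring]]
  simp

/-- The volume of a parabolic cube of radius `r` in `ℝ^m × ℝ`. -/
def cubeVol (m : ℕ) (r : ℝ) : ℝ := (2 * r) ^ m * (2 * r ^ 2)

lemma cubeVol_pos {r : ℝ} (hr : 0 < r) : 0 < cubeVol m r := by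
  unfold cubeVol; positivity

lemma cubeVol_mul (a r : ℝ) : cubeVol m (a * r) = a ^ (m + 2) * cubeVol m r := by
  unfold cubeVol
  rw [show 2 * (a * r) = a * (2 * r) by ring, mul_pow a (2 * r)]
  ring

lemma volume_pcube (c : E m × ℝ) {r : ℝ} (hr : 0 < r) :
    volume (pcube c r) = ENNReal.ofReal (cubeVol m r) := by
  rw [pcube_eq_prod c hr, Measure.volume_eq_prod, Measure.prod_prod, volume_box, Real.volume_Ioo,
    cubeVol, ENNReal.ofReal_mul (p := (2 * r) ^ m) (by positivity),
    ENNReal.ofReal_pow (by positivity)]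
  congr 2
  ring

lemma volume_pcube_ne_top (c : E m × ℝ) {r : ℝ} (hr : 0 < r) : volume (pcube c r) ≠ ⊤ := by
  simp [volume_pcube c hr]

lemma volumeReal_pcube (c : E m × ℝ) {r : ℝ} (hr : 0 < r) :
    volume.real (pcube c r) = cubeVol m r := by
  rw [Measure.real, volume_pcube c hr, ENNReal.toReal_ofReal (cubeVol_pos hr).le]

lemma setAverage_pcube {V : Type*} [NormedAddCommGroup V] [NormedSpace ℝ V] (f : E m × ℝ → V)
    (c : E m × ℝ) {r : ℝ} (hr : 0 < r) :
    ⨍ p in pcube c r, f p = (cubeVol m r)⁻¹ • ∫ p in pcube c r, f p := by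
  rw [setAverage_eq, volumeReal_pcube c hr]

/-- The mean oscillation is controlled by the mean distance to any constant. -/
lemma norm_average_sub_le {V : Type*} [NormedAddCommGroup V] [NormedSpace ℝ V] [CompleteSpace V]
    (f : E m × ℝ → V) (c : E m × ℝ) {r : ℝ} (hr : 0 < r) (A : V) :
    ‖⨍ p in pcube c r, f p - A‖ ≤ ⨍ p in pcube c r, ‖f p - A‖ := by
  rw [setAverage_pcube _ c hr, setAverage_pcube _ c hr, norm_smul, Real.norm_eq_abs,
    abs_of_pos (inv_pos.2 (cubeVol_pos hr)), smul_eq_mul]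
  gcongr
  · exact (inv_pos.2 (cubeVol_pos hr)).le
  · exact norm_integral_le_integral_norm _

lemma integrableOn_sub_const {V : Type*} [NormedAddCommGroup V]
    {f : E m × ℝ → V} {c : E m × ℝ} {r : ℝ} (hr : 0 < r)
    (hf : IntegrableOn f (pcube c r)) (A : V) : IntegrableOn (fun p => f p - A) (pcube c r) :=
  Integrable.sub hf (integrableOn_const (volume_pcube_ne_top c hr))

lemma average_sub_const {V : Type*} [NormedAddCommGroup V] [NormedSpace ℝ V] [CompleteSpace V]
    {f : E m × ℝ → V} {c : E m × ℝ} {r : ℝ} (hr : 0 < r)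
    (hf : IntegrableOn f (pcube c r)) (A : V) :
    ⨍ p in pcube c r, (f p - A) = (⨍ p in pcube c r, f p) - A := by
  rw [setAverage_pcube _ c hr, setAverage_pcube _ c hr,
    integral_sub hf (integrableOn_const (volume_pcube_ne_top c hr)), smul_sub, setIntegral_const,
    volumeReal_pcube c hr, inv_smul_smul₀ (cubeVol_pos hr).ne']

/-- Averages over nested cubes with radii `r` and `2r` are comparable. -/
lemma average_nested {V : Type*} [NormedAddCommGroup V] [NormedSpace ℝ V] [CompleteSpace V]
    {f : E m × ℝ → V} {c c' : E m × ℝ} {r B : ℝ} (hr : 0 < r)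
    (hsub : pcube c r ⊆ pcube c' (2 * r)) (hf : IntegrableOn f (pcube c' (2 * r)))
    (hB : ⨍ p in pcube c' (2 * r), ‖f p - ⨍ q in pcube c' (2 * r), f q‖ ≤ B) :
    ‖(⨍ p in pcube c r, f p) - ⨍ p in pcube c' (2 * r), f p‖ ≤ 2 ^ (m + 2) * B := by
  set A := ⨍ p in pcube c' (2 * r), f p
  have h2r : 0 < 2 * r := by positivity
  have hV := cubeVol_pos (m := m) hr
  have hV2 := cubeVol_pos (m := m) h2r
  rw [← average_sub_const hr (hf.mono_set hsub)]
  refine (norm_average_sub_le f c hr A).trans ?_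
  rw [setAverage_pcube _ _ hr, smul_eq_mul]
  rw [setAverage_pcube _ _ h2r, smul_eq_mul] at hB
  have h1 : ∫ p in pcube c r, ‖f p - A‖ ≤ ∫ p in pcube c' (2 * r), ‖f p - A‖ :=
    setIntegral_mono_set (integrableOn_sub_const h2r hf A).norm
      (Filter.Eventually.of_forall fun _ => norm_nonneg _) hsub.eventuallyLE
  have h2 := cubeVol_mul (m := m) 2 r
  rw [inv_mul_le_iff₀ hV2] at hB
  rw [inv_mul_le_iff₀ hV]
  rw [h2] at hB
  nlinarith

/-- The mean oscillation is at most twice the mean distance to a constant. -/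
lemma oscillation_le_of_lintegral {V : Type*} [NormedAddCommGroup V] [NormedSpace ℝ V]
    [CompleteSpace V] {f : E m × ℝ → V} {c : E m × ℝ} {r B : ℝ} (hr : 0 < r) (hB0 : 0 ≤ B)
    (hf : IntegrableOn f (pcube c r)) (A : V)
    (hB : ∫⁻ p in pcube c r, ‖f p - A‖ₑ ≤ ENNReal.ofReal B * volume (pcube c r)) :
    ⨍ p in pcube c r, ‖f p - ⨍ q in pcube c r, f q‖ ≤ 2 * B := by
  have hV := cubeVol_pos (m := m) hr
  have hA := integrableOn_sub_const hr hf A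
  have h1 : ⨍ p in pcube c r, ‖f p - A‖ ≤ B := by
    rw [setAverage_pcube _ _ hr, smul_eq_mul, inv_mul_le_iff₀ hV,
      integral_norm_eq_lintegral_enorm hA.aestronglyMeasurable]
    rw [volume_pcube c hr, ← ENNReal.ofReal_mul hB0] at hB
    refine (ENNReal.toReal_mono ENNReal.ofReal_ne_top hB).trans ?_
    rw [ENNReal.toReal_ofReal (by positivity), mul_comm]
  set a := ⨍ q in pcube c r, f q with ha
  have h2 : ‖a - A‖ ≤ B := by
    rw [ha, ← average_sub_const hr hf]
    exact (norm_average_sub_le f c hr A).trans h1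
  calc ⨍ p in pcube c r, ‖f p - a‖ ≤ ⨍ p in pcube c r, (‖f p - A‖ + ‖a - A‖) := by
        rw [setAverage_pcube _ _ hr, setAverage_pcube _ _ hr, smul_eq_mul, smul_eq_mul]
        gcongr
        · exact (integrableOn_sub_const hr hf a).norm
        · exact hA.norm.add (integrableOn_const (volume_pcube_ne_top c hr))
        · exact (measurableSet_pcube c hr).nullMeasurableSet
        · rename_i p _
          have := norm_sub_le (f p - A) (a - A)
          simpa using this
    _ = (⨍ p in pcube c r, ‖f p - A‖) + ‖a - A‖ := by
        have := average_sub_const hr hA.norm (-‖a - A‖)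
        simpa using this
    _ ≤ 2 * B := by linarith

lemma lintegral_enorm_sub_le_of_average {V : Type*} [NormedAddCommGroup V] [NormedSpace ℝ V]
    [CompleteSpace V] {f : E m × ℝ → V} {c : E m × ℝ} {r B : ℝ} (hr : 0 < r)
    (hf : IntegrableOn f (pcube c r)) (A : V)
    (hB : ⨍ p in pcube c r, ‖f p - A‖ ≤ B) :
    ∫⁻ p in pcube c r, ‖f p - A‖ₑ ≤ ENNReal.ofReal B * volume (pcube c r) := by
  have hV := cubeVol_pos (m := m) hr
  have hA := integrableOn_sub_const hr hf A
  have hI : 0 ≤ ∫ p in pcube c r, ‖f p - A‖ := integral_nonneg fun _ => norm_nonneg _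
  rw [setAverage_pcube _ _ hr, smul_eq_mul, inv_mul_le_iff₀ hV] at hB
  have hB0 : 0 ≤ B := by
    by_contra! h
    nlinarith
  rw [← ofReal_integral_norm_eq_lintegral_enorm hA, volume_pcube c hr, ← ENNReal.ofReal_mul hB0]
  apply ENNReal.ofReal_le_ofReal
  linarith

lemma pcube_subset_pcube {c c' : E m × ℝ} {r r' : ℝ} (hr : 0 < r) (hr' : 0 < r')
    (hx : ∀ i, |c.1 i - c'.1 i| ≤ r' - r) (ht : |c.2 - c'.2| ≤ r' ^ 2 - r ^ 2) :
    pcube c r ⊆ pcube c' r' := by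
  intro p hp
  rw [mem_pcube_iff hr] at hp
  rw [mem_pcube_iff hr']
  refine ⟨fun i => ?_, ?_⟩
  · have := abs_add_le (p.1 i - c.1 i) (c.1 i - c'.1 i)
    rw [sub_add_sub_cancel] at this
    linarith [hp.1 i, hx i]
  · have := abs_add_le (p.2 - c.2) (c.2 - c'.2)
    rw [sub_add_sub_cancel] at this
    linarith [hp.2]

/-- Averages over cubes of radius `r` inside the big cube differ from the average over the big cube
by at most a multiple of the logarithm of the ratio of the radii. -/
lemma average_chain {V : Type*} [NormedAddCommGroup V] [NormedSpace ℝ V] [CompleteSpace V]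
    {f : E m × ℝ → V} {r R B : ℝ} {k : ℕ} (hr : 0 < r) (hR : R = 2 ^ k * r)
    (hf : IntegrableOn f (pcube 0 (2 * R))) (hB : BMOleOn f (pcube 0 (2 * R)) B)
    {x : E m} (hx : ∀ i, |x i| ≤ 2 * R - r) :
    ‖(⨍ p in pcube (x, 0) r, f p) - ⨍ p in pcube 0 (2 * R), f p‖
      ≤ (k + 1) * (2 ^ (m + 2) * B) := by
  have hRr : r ≤ R := by
    rw [hR]
    have : (1 : ℝ) ≤ 2 ^ k := one_le_pow₀ (by norm_num)
    nlinarith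
  have hd : 0 < 2 * R - r := by linarith
  let y : ℝ → E m × ℝ := fun s => (((2 * R - s) / (2 * R - r)) • x, 0)
  have hyr : y r = (x, 0) := by simp [y, div_self hd.ne']
  have hsub : ∀ s s', 0 < s → s ≤ s' → s' ≤ 2 * R → pcube (y s) s ⊆ pcube (y s') s' := by
    intro s s' hs hss _
    refine pcube_subset_pcube hs (hs.trans_le hss) (fun i => ?_) ?_
    · have : (y s).1 i - (y s').1 i = (s' - s) / (2 * R - r) * x i := by
        simp [y]; field_simp; ring
      rw [this, abs_mul, abs_of_nonneg (div_nonneg (by linarith) hd.le), div_mul_eq_mul_div,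
        div_le_iff₀ hd]
      exact mul_le_mul_of_nonneg_left (hx i) (by linarith)
    · simp only [y, sub_self, abs_zero]
      nlinarith
  have hy0 : y (2 * R) = 0 := by simp [y, Prod.zero_eq_mk]
  have hpow : ∀ j : ℕ, j ≤ k + 1 → 2 ^ j * r ≤ 2 * R := by
    intro j hj
    rw [hR, ← mul_assoc, ← pow_succ']
    gcongr
    norm_num
  have key : ∀ j : ℕ, j ≤ k + 1 →
      ‖(⨍ p in pcube (x, 0) r, f p) - ⨍ p in pcube (y (2 ^ j * r)) (2 ^ j * r), f p‖
        ≤ j * (2 ^ (m + 2) * B) := by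
    intro j
    induction j with
    | zero => intro _; simp [hyr]
    | succ j ih =>
      intro hj
      have h1 := ih (by omega)
      have hj' := hpow (j + 1) hj
      have e : (2 : ℝ) ^ (j + 1) * r = 2 * (2 ^ j * r) := by ring
      rw [e] at hj' ⊢
      have hp : 0 < 2 ^ j * r := by positivity
      have hs2 : pcube (y (2 * (2 ^ j * r))) (2 * (2 ^ j * r)) ⊆ pcube 0 (2 * R) := by
        have := hsub (2 * (2 ^ j * r)) (2 * R) (by positivity) hj' le_rfl
        rwa [hy0] at this
      have h2 := average_nested hp (hsub _ (2 * (2 ^ j * r)) hp (by linarith) hj')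
        (hf.mono_set hs2) (hB _ _ (by positivity) hs2)
      refine (norm_sub_le_norm_sub_add_norm_sub _
        (⨍ p in pcube (y (2 ^ j * r)) (2 ^ j * r), f p) _).trans ?_
      push_cast
      linarith
  have h := key (k + 1) le_rfl
  have e : (2 : ℝ) ^ (k + 1) * r = 2 * R := by rw [hR]; ring
  rw [e, hy0] at h
  exact_mod_cast h

lemma LipPar.continuousOn {φ : E m × ℝ → ℝ} {ℓ : ℝ} {S : Set (E m × ℝ)} (h : LipPar φ ℓ S) :
    ContinuousOn φ S := by
  intro p hp
  refine tendsto_iff_norm_sub_tendsto_zero.2 ?_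
  have hc : Filter.Tendsto (fun q : E m × ℝ => ℓ * pdist q p) (nhdsWithin p S) (nhds 0) := by
    have : ContinuousWithinAt (fun q : E m × ℝ => ℓ * pdist q p) S p := by
      unfold pdist
      fun_prop
    simpa [ContinuousWithinAt, pdist] using this
  refine tendsto_of_tendsto_of_tendsto_of_le_of_le' tendsto_const_nhds hc
    (Filter.Eventually.of_forall fun _ => norm_nonneg _) ?_
  filter_upwards [self_mem_nhdsWithin] with q hq
  exact h q hq p hp

lemma LipPar.measurable_indicator {φ : E m × ℝ → ℝ} {ℓ : ℝ} {S : Set (E m × ℝ)}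
    (h : LipPar φ ℓ S) (hS : MeasurableSet S) : Measurable (S.indicator φ) := by
  classical
  rw [← piecewise_eq_indicator]
  exact h.continuousOn.measurable_piecewise continuousOn_const hS

lemma LipPar.norm_gradient_le {φ : E m × ℝ → ℝ} {ℓ : ℝ} {S : Set (E m × ℝ)} (h : LipPar φ ℓ S)
    (hℓ : 0 ≤ ℓ) (hS : IsOpen S) {p : E m × ℝ} (hp : p ∈ S) {v : E m}
    (hv : HasGradientAt (fun x => φ (x, p.2)) v p.1) : ‖v‖ ≤ ℓ := by
  have := hv.hasFDerivAt.le_of_lip' hℓ ?_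
  · simpa using this
  · have : ∀ᶠ x in nhds p.1, (x, p.2) ∈ S :=
      (Continuous.prodMk_left p.2).continuousAt.eventually (hS.mem_nhds hp)
    filter_upwards [this] with x hx
    simpa [pdist] using h _ hx _ hp

lemma IsSpatialGradientOn.aemeasurable {φ : E m × ℝ → ℝ} {ℓ : ℝ} {g : E m × ℝ → E m}
    {S : Set (E m × ℝ)} (h : LipPar φ ℓ S) (hS : IsOpen S) (hg : IsSpatialGradientOn φ g S) :
    AEMeasurable g (volume.restrict S) := by
  have hcoord : ∀ i, AEMeasurable (fun p => g p i) (volume.restrict S) := by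
    intro i
    have hφ := h.measurable_indicator hS.measurableSet
    let v : E m := EuclideanSpace.single i 1
    let u : ℕ → ℝ := fun n => 1 / ((n : ℝ) + 1)
    have hu0 : Filter.Tendsto u Filter.atTop (nhds 0) := tendsto_one_div_add_atTop_nhds_zero_nat
    have hu : Filter.Tendsto u Filter.atTop (nhdsWithin 0 {0}ᶜ) :=
      tendsto_nhdsWithin_iff.2 ⟨hu0, Filter.Eventually.of_forall fun n =>
        (show (0 : ℝ) < 1 / ((n : ℝ) + 1) by positivity).ne'⟩
    refine aemeasurable_of_tendsto_metrizable_ae (u := Filter.atTop)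
      (f := fun (n : ℕ) (p : E m × ℝ) =>
        (u n)⁻¹ * (S.indicator φ (p.1 + u n • v, p.2) - S.indicator φ p)) ?_ ?_
    · intro n
      exact (((hφ.comp (by fun_prop : Measurable fun p : E m × ℝ =>
        (p.1 + u n • v, p.2))).sub hφ).const_mul _).aemeasurable
    · filter_upwards [hg, ae_restrict_mem hS.measurableSet] with p hp hpS
      have hd := (hasDerivAt_iff_tendsto_slope_zero.1 (hp.hasFDerivAt.hasLineDerivAt v)).comp hu
      have hval : (InnerProductSpace.toDual ℝ (E m)) (g p) v = g p i := by
        simp [v, EuclideanSpace.inner_single_right]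
      rw [hval] at hd
      refine hd.congr' ?_
      have hev : ∀ᶠ n in Filter.atTop, (p.1 + u n • v, p.2) ∈ S := by
        have hc : Filter.Tendsto (fun n => (p.1 + u n • v, p.2)) Filter.atTop (nhds p) := by
          have : Continuous fun s : ℝ => (p.1 + s • v, p.2) := by fun_prop
          simpa [Function.comp_def] using (this.tendsto 0).comp hu0
        exact hc.eventually (hS.mem_nhds hpS)
      filter_upwards [hev] with n hn
      simp [indicator_of_mem hn, indicator_of_mem hpS]
  have : g = fun p => (MeasurableEquiv.toLp 2 (Fin m → ℝ)) (fun i => g p i) := by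
    ext p i
    simp
  rw [this]
  exact (MeasurableEquiv.measurable _).comp_aemeasurable (aemeasurable_pi_iff.2 hcoord)

/-- The spatial gradient of a `Lip(1,1/2)` function has an everywhere bounded Borel version. -/
lemma IsSpatialGradientOn.exists_measurable {φ : E m × ℝ → ℝ} {ℓ : ℝ} {g : E m × ℝ → E m}
    {S : Set (E m × ℝ)} (h : LipPar φ ℓ S) (hℓ : 0 ≤ ℓ) (hS : IsOpen S)
    (hg : IsSpatialGradientOn φ g S) :
    ∃ G : E m × ℝ → E m, Measurable G ∧ (∀ p, ‖G p‖ ≤ ℓ) ∧ g =ᵐ[volume.restrict S] G := by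
  classical
  have hm := hg.aemeasurable h hS
  refine ⟨fun p => if ‖hm.mk g p‖ ≤ ℓ then hm.mk g p else 0, ?_, ?_, ?_⟩
  · exact Measurable.ite (measurableSet_le hm.measurable_mk.norm measurable_const)
      hm.measurable_mk measurable_const
  · intro p
    dsimp only
    split_ifs with hp
    · exact hp
    · simpa using hℓ
  · filter_upwards [hg, ae_restrict_mem hS.measurableSet, hm.ae_eq_mk] with p hp hpS hpe
    rw [← hpe, if_pos (h.norm_gradient_le hℓ hS hpS hp)]

lemma integrableOn_pcube_of_bounded {V : Type*} [NormedAddCommGroup V]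
    {f : E m × ℝ → V} {c : E m × ℝ} {r C : ℝ} (hr : 0 < r) (hf : AEStronglyMeasurable f volume)
    (hC : ∀ p, ‖f p‖ ≤ C) : IntegrableOn f (pcube c r) :=
  Measure.integrableOn_of_bounded (volume_pcube_ne_top c hr) hf
    (Filter.Eventually.of_forall hC)

instance isAddRightInvariant_volume :
    (volume : Measure (E m × ℝ)).IsAddRightInvariant := by
  rw [Measure.volume_eq_prod]
  infer_instance

lemma preimage_add_pcube (v : E m) {r : ℝ} (hr : 0 < r) :
    (fun p : E m × ℝ => p + (v, 0)) ⁻¹' pcube (v, 0) r = pcube 0 r := by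
  ext p
  simp [mem_pcube_iff hr]

lemma measurePreserving_add_pcube (v : E m) {r : ℝ} (hr : 0 < r) :
    MeasurePreserving (fun p : E m × ℝ => p + (v, 0)) (volume.restrict (pcube 0 r))
      (volume.restrict (pcube (v, 0) r)) := by
  have := (measurePreserving_add_right (volume : Measure (E m × ℝ)) (v, 0)).restrict_preimage
    (measurableSet_pcube (v, (0 : ℝ)) hr)
  rwa [preimage_add_pcube v hr] at this

lemma average_translate {V : Type*} [NormedAddCommGroup V] [NormedSpace ℝ V]
    (f : E m × ℝ → V) (v : E m) {r : ℝ} (hr : 0 < r) :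
    ⨍ p in pcube 0 r, f (p + (v, 0)) = ⨍ p in pcube (v, 0) r, f p := by
  have := (measurePreserving_add_right (volume : Measure (E m × ℝ))
    (v, 0)).setIntegral_preimage_emb (measurableEmbedding_addRight (v, (0 : ℝ))) f (pcube (v, 0) r)
  rw [preimage_add_pcube v hr] at this
  rw [setAverage_pcube _ _ hr, setAverage_pcube _ _ hr, this]

lemma hasDerivAt_average_translate {φ : E m × ℝ → ℝ} {G : E m × ℝ → E m} {ℓ r ϱ : ℝ}
    (hr : 0 < r) (hϱ : r < ϱ) (hℓ : 0 ≤ ℓ) (h : LipPar φ ℓ (pcube 0 ϱ)) (hG : Measurable G)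
    (hGℓ : ∀ p, ‖G p‖ ≤ ℓ)
    (hg : IsSpatialGradientOn φ G (pcube 0 ϱ)) {x : E m} (hx : ∀ i, |x i| < ϱ - r)
    {σ : ℝ} (hσ : σ ∈ Icc (0 : ℝ) 1) :
    HasDerivAt (fun s : ℝ => ⨍ p in pcube 0 r, φ (p + (s • x, 0)))
      (inner (𝕜 := ℝ) x (⨍ p in pcube (σ • x, 0) r, G p)) σ := by
  have hϱ0 : 0 < ϱ := hr.trans hϱ
  let U : Set ℝ := {s | ∀ i, |s * x i| < ϱ - r}
  have hU : IsOpen U := by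
    simp only [U, ofPred_forall]
    exact isOpen_iInter_of_finite fun i => isOpen_lt (by fun_prop) continuous_const
  have hσU : σ ∈ U := by
    intro i
    rw [abs_mul, abs_of_nonneg hσ.1]
    nlinarith [hσ.2, abs_nonneg (x i), hx i]
  have hsub : ∀ s ∈ U, pcube (s • x, 0) r ⊆ pcube 0 ϱ := by
    intro s hs
    refine pcube_subset_pcube hr hϱ0 (fun i => ?_) ?_
    · simpa using (hs i).le
    · simp only [Prod.snd_zero, sub_self, abs_zero]
      nlinarith
  have hmem : ∀ s ∈ U, ∀ p ∈ pcube (0 : E m × ℝ) r, p + (s • x, 0) ∈ pcube (0 : E m × ℝ) ϱ := by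
    intro s hs p hp
    apply hsub s hs
    rwa [← preimage_add_pcube (s • x) hr] at hp
  have hcont : ∀ s ∈ U, AEStronglyMeasurable (fun p : E m × ℝ => φ (p + (s • x, 0)))
      (volume.restrict (pcube 0 r)) := by
    intro s hs
    refine ContinuousOn.aestronglyMeasurable ?_ (measurableSet_pcube 0 hr)
    exact h.continuousOn.comp (by fun_prop) (hmem s hs)
  have hG' : AEStronglyMeasurable (fun p : E m × ℝ => inner (𝕜 := ℝ) x (G (p + (σ • x, 0))))
      (volume.restrict (pcube 0 r)) := by
    refine Measurable.aestronglyMeasurable ?_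
    have : Measurable fun p : E m × ℝ => G (p + (σ • x, 0)) := hG.comp (by fun_prop)
    exact measurable_const.inner this
  have hmain := hasDerivAt_integral_of_dominated_loc_of_lip
    (μ := volume.restrict (pcube (0 : E m × ℝ) r)) (bound := fun _ => ℓ * ‖x‖)
    (F := fun (s : ℝ) p => φ (p + (s • x, 0))) (x₀ := σ) (s := U)
    (F' := fun p => inner (𝕜 := ℝ) x (G (p + (σ • x, 0)))) (hU.mem_nhds hσU)
    (by filter_upwards [hU.mem_nhds hσU] with s hs using hcont s hs) ?_ hG' ?_ ?_ ?_
  · have h2 := hmain.2.const_mul (cubeVol m r)⁻¹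
    have e : inner (𝕜 := ℝ) x (⨍ p in pcube (σ • x, 0) r, G p)
        = (cubeVol m r)⁻¹ * ∫ p in pcube 0 r, inner (𝕜 := ℝ) x (G (p + (σ • x, 0))) := by
      rw [← average_translate _ _ hr, setAverage_pcube _ _ hr, real_inner_smul_right,
        integral_inner]
      refine Measure.integrableOn_of_bounded (M := ℓ) (volume_pcube_ne_top 0 hr) ?_
        (Filter.Eventually.of_forall fun p => hGℓ _)
      exact (hG.comp (by fun_prop)).aestronglyMeasurable
    rw [e]
    simpa only [setAverage_pcube _ _ hr, smul_eq_mul] using h2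
  · have h0 : (0 : E m × ℝ) ∈ pcube (0 : E m × ℝ) ϱ := by simp [mem_pcube_iff hϱ0, hϱ0]
    refine ⟨hcont σ hσU, HasFiniteIntegral.restrict_of_bounded (C := |φ 0| + ℓ * (m * ϱ + ϱ))
      (volume_pcube_ne_top 0 hr).lt_top ?_⟩
    filter_upwards [ae_restrict_mem (measurableSet_pcube 0 hr)] with p hp
    have hq := hmem σ hσU p hp
    have h1 := h _ hq _ h0
    have hq' := hq
    rw [mem_pcube_iff hϱ0] at hq'
    have h2 : pdist (p + (σ • x, 0)) 0 ≤ m * ϱ + ϱ := by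
      refine add_le_add (norm_le_of_coord_le hϱ0.le fun i => (hq'.1 i).le) hq.2.le
    have h3 : |φ (p + (σ • x, 0))| ≤ |φ (p + (σ • x, 0)) - φ 0| + |φ 0| := by
      simpa using abs_add_le (φ (p + (σ • x, 0)) - φ 0) (φ 0)
    have h4 := mul_le_mul_of_nonneg_left h2 hℓ
    rw [Real.norm_eq_abs]
    linarith
  · filter_upwards [ae_restrict_mem (measurableSet_pcube 0 hr)] with p hp
    refine LipschitzOnWith.of_dist_le_mul fun s hs s' hs' => ?_
    have h1 := h _ (hmem s hs p hp) _ (hmem s' hs' p hp)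
    have h2 : pdist (p + (s • x, 0)) (p + (s' • x, 0)) = ‖x‖ * dist s s' := by
      simp [pdist, ← sub_smul, norm_smul, Real.dist_eq, mul_comm]
    rw [h2] at h1
    rw [Real.dist_eq, Real.coe_nnabs, abs_of_nonneg (mul_nonneg hℓ (norm_nonneg x))]
    linarith
  · exact integrableOn_const (volume_pcube_ne_top 0 hr)
  · have h1 := (measurePreserving_add_pcube (σ • x) hr).quasiMeasurePreserving.ae
      (ae_mono (Measure.restrict_mono_set _ (hsub σ hσU)) hg)
    filter_upwards [h1] with p hp
    have hc : HasDerivAt (fun s : ℝ => p.1 + s • x) x σ := by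
      simpa using ((hasDerivAt_id σ).smul_const x).const_add p.1
    have := HasFDerivAt.comp_hasDerivAt σ (f := fun s : ℝ => p.1 + s • x) hp.hasFDerivAt hc
    simpa [Function.comp_def, real_inner_comm, Prod.add_def] using this

/-- A `Lip(1,1/2)` function whose spatial gradient has small mean oscillation is close to an affine
function, up to the time oscillation at the small scale. -/
lemma abs_sub_inner_le {φ : E m × ℝ → ℝ} {G : E m × ℝ → E m} {ℓ r R B : ℝ} {k : ℕ}
    (hr : 0 < r) (hR : R = 2 ^ k * r) (hℓ : 0 ≤ ℓ) (h : LipPar φ ℓ (pcube 0 (2 * R)))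
    (hφ0 : φ 0 = 0) (hG : Measurable G) (hGℓ : ∀ p, ‖G p‖ ≤ ℓ)
    (hg : IsSpatialGradientOn φ G (pcube 0 (2 * R))) (hB0 : 0 ≤ B)
    (hB : BMOleOn G (pcube 0 (2 * R)) B)
    {x : E m} (hx : ∀ i, |x i| < 2 * R) {t : ℝ} (ht : |t| ≤ r ^ 2) :
    |φ (x, t) - inner (𝕜 := ℝ) x (⨍ q in pcube 0 r, G q)|
      ≤ (4 * m + 3) * (ℓ * r) + 2 * R * m * (2 * (k + 1) * (2 ^ (m + 2) * B)) := by
  have hRr : r ≤ R := by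
    rw [hR]
    have : (1 : ℝ) ≤ 2 ^ k := one_le_pow₀ (by norm_num)
    nlinarith
  have hR0 : 0 < R := hr.trans_le hRr
  have h2R : 0 < 2 * R := by positivity
  set c := ⨍ q in pcube 0 r, G q with hc
  have hGi : ∀ c' s, 0 < s → IntegrableOn G (pcube c' s) := fun c' s hs =>
    integrableOn_pcube_of_bounded hs hG.aestronglyMeasurable hGℓ
  have hcℓ : ‖c‖ ≤ ℓ := by
    rw [hc, setAverage_pcube _ _ hr, norm_smul, Real.norm_eq_abs,
      abs_of_pos (inv_pos.2 (cubeVol_pos hr)), inv_mul_le_iff₀ (cubeVol_pos hr), mul_comm]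
    have := norm_setIntegral_le_of_norm_le_const (μ := volume) (f := G)
      (volume_pcube_ne_top (0 : E m × ℝ) hr).lt_top fun p _ => hGℓ p
    rwa [volumeReal_pcube _ hr] at this
  set x' : E m := ((2 * R - r) / (2 * R)) • x with hx'
  have hx'i : ∀ i, |x' i| < 2 * R - r := by
    intro i
    simp only [hx', PiLp.smul_apply, smul_eq_mul, abs_mul]
    rw [abs_of_nonneg (div_nonneg (by linarith) h2R.le), div_mul_eq_mul_div, div_lt_iff₀ h2R]
    exact mul_lt_mul_of_pos_left (hx i) (by linarith)
  have hxx' : ‖x - x'‖ ≤ m * r := by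
    refine norm_le_of_coord_le hr.le fun i => ?_
    have : (x - x') i = r / (2 * R) * x i := by
      simp only [hx', PiLp.sub_apply, PiLp.smul_apply, smul_eq_mul]
      field_simp
      ring
    rw [this, abs_mul, abs_of_nonneg (by positivity), div_mul_eq_mul_div, div_le_iff₀ h2R]
    exact mul_le_mul_of_nonneg_left (hx i).le hr.le
  have hx'n : ‖x'‖ ≤ m * (2 * R) :=
    norm_le_of_coord_le h2R.le fun i => by linarith [hx'i i]
  have hsub : ∀ v : E m, (∀ i, |v i| ≤ 2 * R - r) → pcube (v, 0) r ⊆ pcube 0 (2 * R) := by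
    intro v hv
    refine pcube_subset_pcube hr h2R (fun i => ?_) ?_
    · simpa using hv i
    · simp only [Prod.snd_zero, sub_self, abs_zero]
      nlinarith
  have hmemx : (x, t) ∈ pcube (0 : E m × ℝ) (2 * R) := by
    rw [mem_pcube_iff h2R]
    refine ⟨by simpa using hx, ?_⟩
    simp only [Prod.snd_zero, sub_zero]
    nlinarith
  have hctr : ∀ v : E m, (v, (0 : ℝ)) ∈ pcube (v, 0) r := by
    intro v
    simp [mem_pcube_iff hr, hr]
  -- averaging at the small scale
  let K : ℝ → ℝ := fun s => ⨍ p in pcube 0 r, φ (p + (s • x', 0))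
  have hclose : ∀ s ∈ Icc (0 : ℝ) 1, |φ (s • x', 0) - K s| ≤ ℓ * (m * r + r) := by
    intro s hs
    have hsi : ∀ i, |(s • x') i| ≤ 2 * R - r := by
      intro i
      simp only [PiLp.smul_apply, smul_eq_mul, abs_mul, abs_of_nonneg hs.1]
      nlinarith [hs.2, abs_nonneg (x' i), hx'i i]
    have hs' := hsub (s • x') hsi
    have hdist : ∀ p ∈ pcube (s • x', (0 : ℝ)) r,
        ‖φ p - φ (s • x', 0)‖ ≤ ℓ * (m * r + r) := by
      intro p hp
      refine (h p (hs' hp) _ (hs' (hctr _))).trans (mul_le_mul_of_nonneg_left ?_ hℓ)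
      exact add_le_add (norm_le_of_coord_le hr.le fun i => (hp.1 i).le) hp.2.le
    have h_int : IntegrableOn φ (pcube (s • x', 0) r) := by
      refine ⟨(h.continuousOn.mono hs').aestronglyMeasurable (measurableSet_pcube _ hr),
        HasFiniteIntegral.restrict_of_bounded (C := ℓ * (m * r + r) + |φ (s • x', 0)|)
        (volume_pcube_ne_top _ hr).lt_top ?_⟩
      filter_upwards [ae_restrict_mem (measurableSet_pcube _ hr)] with p hp
      have h1 := hdist p hp
      have h2 := norm_add_le (φ p - φ (s • x', 0)) (φ (s • x', 0))
      rw [sub_add_cancel] at h2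
      exact h2.trans (add_le_add_left h1 _)
    have e : K s - φ (s • x', 0) = ⨍ p in pcube (s • x', 0) r, (φ p - φ (s • x', 0)) := by
      rw [average_sub_const hr h_int, ← average_translate _ _ hr]
    rw [abs_sub_comm, e, setAverage_pcube _ _ hr, smul_eq_mul, abs_mul,
      abs_of_pos (inv_pos.2 (cubeVol_pos hr)), inv_mul_le_iff₀ (cubeVol_pos hr), mul_comm]
    have := norm_setIntegral_le_of_norm_le_const (μ := volume)
      (f := fun p => φ p - φ (s • x', 0))
      (volume_pcube_ne_top (s • x', (0 : ℝ)) hr).lt_top hdist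
    rwa [volumeReal_pcube _ hr] at this
  have hK : |K 1 - K 0 - inner (𝕜 := ℝ) x' c|
      ≤ ‖x'‖ * (2 * (k + 1) * (2 ^ (m + 2) * B)) := by
    have hmv := norm_image_sub_le_of_norm_deriv_le_segment_01'
      (f := fun s => K s - s * inner (𝕜 := ℝ) x' c)
      (f' := fun s => inner (𝕜 := ℝ) x' (⨍ p in pcube (s • x', 0) r, G p)
        - inner (𝕜 := ℝ) x' c) (C := ‖x'‖ * (2 * (k + 1) * (2 ^ (m + 2) * B))) ?_ ?_
    · simp only [Real.norm_eq_abs, one_mul, zero_mul, sub_zero] at hmv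
      convert hmv using 2
      ring
    · intro s hs
      refine HasDerivAt.hasDerivWithinAt ?_
      refine (hasDerivAt_average_translate hr (by linarith) hℓ h hG hGℓ hg hx'i hs).sub ?_
      simpa using (hasDerivAt_id s).mul_const (inner (𝕜 := ℝ) x' c)
    · intro s hs
      rw [← inner_sub_right]
      refine (norm_inner_le_norm _ _).trans (mul_le_mul_of_nonneg_left ?_ (norm_nonneg _))
      have hsi : ∀ i, |(s • x') i| ≤ 2 * R - r := by
        intro i
        simp only [PiLp.smul_apply, smul_eq_mul, abs_mul, abs_of_nonneg hs.1]
        nlinarith [hs.2, abs_nonneg (x' i), hx'i i]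
      have h1 := average_chain hr hR (hGi 0 _ h2R) hB hsi
      have h2 := average_chain hr hR (hGi 0 _ h2R) hB (x := 0) (fun i => by simp; linarith)
      rw [norm_sub_rev] at h2
      have h3 := norm_sub_le_norm_sub_add_norm_sub (⨍ p in pcube (s • x', 0) r, G p)
        (⨍ p in pcube 0 (2 * R), G p) c
      rw [← Prod.zero_eq_mk, ← hc] at h2
      linarith
  have h1 := hclose 1 (by simp)
  have h0 := hclose 0 (by simp)
  rw [one_smul] at h1
  rw [zero_smul, ← Prod.zero_eq_mk, hφ0] at h0
  have hφx : |φ (x, t) - φ (x', 0)| ≤ ℓ * (m * r + r) := by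
    refine (h _ hmemx _ (hsub x' (fun i => (hx'i i).le) (hctr _))).trans
      (mul_le_mul_of_nonneg_left (add_le_add hxx' ?_) hℓ)
    simp only [sub_zero]
    exact Real.sqrt_le_iff.2 ⟨hr.le, ht⟩
  have hin : |inner (𝕜 := ℝ) (x - x') c| ≤ m * r * ℓ :=
    (abs_real_inner_le_norm _ _).trans (by gcongr)
  have hx'K : ‖x'‖ * (2 * (k + 1) * (2 ^ (m + 2) * B))
      ≤ m * (2 * R) * (2 * (k + 1) * (2 ^ (m + 2) * B)) := by gcongr
  rw [inner_sub_left] at hin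
  rw [abs_le] at *
  constructor <;> nlinarith
/-- The `j`-th time interval of length `2r²` of the reflected tiling. -/
def piece (r : ℝ) (j : ℤ) : Set ℝ := Ico ((2 * j - 1) * r ^ 2) ((2 * j + 1) * r ^ 2)

/-- The isometry of `ℝ` which coincides with `tileT r` on `piece r j`. -/
def fold (r : ℝ) (j : ℤ) (t : ℝ) : ℝ := if Even j then t - 2 * j * r ^ 2 else 2 * j * r ^ 2 - t

lemma tileT_eq_fold {r : ℝ} (hr : 0 < r) {j : ℤ} {t : ℝ} (ht : t ∈ piece r j) :
    tileT r t = fold r j t := by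
  have hr2 : 0 < r ^ 2 := by positivity
  obtain ⟨h1, h2⟩ := ht
  rcases Int.even_or_odd j with hj | hj
  · obtain ⟨i, rfl⟩ := hj
    push_cast at h1 h2
    have hk : ⌊(t + r ^ 2) / (4 * r ^ 2)⌋ = i := by
      rw [Int.floor_eq_iff, le_div_iff₀ (by positivity), div_lt_iff₀ (by positivity)]
      constructor <;> linarith
    simp only [tileT, hk, fold, Even.add_self, if_true]
    rw [if_pos (by linarith)]
    push_cast
    ring
  · have hne : ¬ Even j := Int.not_even_iff_odd.2 hj
    obtain ⟨i, rfl⟩ := hj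
    push_cast at h1 h2
    have hk : ⌊(t + r ^ 2) / (4 * r ^ 2)⌋ = i := by
      rw [Int.floor_eq_iff, le_div_iff₀ (by positivity), div_lt_iff₀ (by positivity)]
      constructor <;> linarith
    simp only [tileT, hk, fold, if_neg hne]
    push_cast
    split_ifs <;> linarith

lemma exists_mem_piece {r : ℝ} (hr : 0 < r) (t : ℝ) : ∃ j, t ∈ piece r j := by
  have hr2 : 0 < 2 * r ^ 2 := by positivity
  refine ⟨⌊(t + r ^ 2) / (2 * r ^ 2)⌋, ?_, ?_⟩
  · have := (le_div_iff₀ hr2).1 (Int.floor_le ((t + r ^ 2) / (2 * r ^ 2)))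
    linarith
  · have := (div_lt_iff₀ hr2).1 (Int.lt_floor_add_one ((t + r ^ 2) / (2 * r ^ 2)))
    linarith

lemma lt_add_one_of_mem_piece {r : ℝ} (hr : 0 < r) {i j : ℤ} {s t : ℝ} (hs : s ∈ piece r i)
    (ht : t ∈ piece r j) {n : ℤ} (hst : s - t < 2 * n * r ^ 2) : i < j + n + 1 := by
  have hr2 : 0 < r ^ 2 := by positivity
  have : ((2 * i - 1 : ℤ) : ℝ) * r ^ 2 < ((2 * j + 1 + 2 * n : ℤ) : ℝ) * r ^ 2 := by
    push_cast
    linarith [hs.1, ht.2]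
  have := Int.cast_lt.1 (lt_of_mul_lt_mul_right this hr2.le)
  omega

lemma abs_tileT_le {r : ℝ} (hr : 0 < r) (t : ℝ) : |tileT r t| ≤ r ^ 2 := by
  obtain ⟨j, hj⟩ := exists_mem_piece hr t
  rw [tileT_eq_fold hr hj, fold, abs_le]
  split_ifs <;> constructor <;> linarith [hj.1, hj.2]

lemma measurable_tileT (r : ℝ) : Measurable (tileT r) := by
  have hk : Measurable fun t : ℝ => ((⌊(t + r ^ 2) / (4 * r ^ 2)⌋ : ℤ) : ℝ) :=
    (measurable_of_countable (fun n : ℤ => (n : ℝ))).comp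
      (Int.measurable_floor.comp (by fun_prop))
  have hs : Measurable fun t : ℝ => t - 4 * ((⌊(t + r ^ 2) / (4 * r ^ 2)⌋ : ℤ) : ℝ) * r ^ 2 := by
    fun_prop
  exact Measurable.ite (measurableSet_le hs measurable_const) hs (measurable_const.sub hs)

lemma abs_tileT_sub_le_of_le {r : ℝ} (hr : 0 < r) {s t : ℝ} (hst : s ≤ t)
    (h : t - s < 2 * r ^ 2) : |tileT r s - tileT r t| ≤ t - s := by
  obtain ⟨i, hi⟩ := exists_mem_piece hr s
  obtain ⟨j, hj⟩ := exists_mem_piece hr t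
  have h1 := lt_add_one_of_mem_piece hr (n := 0) (i := i) (j := j + 1) (s := s) (t := t + 2 * r ^ 2)
    hi ⟨by push_cast; linarith [hj.1], by push_cast; linarith [hj.2]⟩
    (by push_cast; nlinarith [sq_pos_of_pos hr])
  have h2 := lt_add_one_of_mem_piece hr (n := 1) hj hi (by push_cast; linarith)
  have hij : i ≤ j := by
    by_contra! hlt
    have : ((j + 1 : ℤ) : ℝ) ≤ i := Int.cast_le.2 hlt
    push_cast at this
    nlinarith [hi.1, hj.2, sq_pos_of_pos hr]
  rw [tileT_eq_fold hr hi, tileT_eq_fold hr hj, fold, fold, abs_le]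
  obtain rfl | rfl : j = i ∨ j = i + 1 := by omega
  · split_ifs <;> constructor <;> linarith
  · have := hi.2
    have := hj.1
    push_cast at *
    by_cases he : Even i
    · have : ¬ Even (i + 1) := by rw [Int.even_add_one]; exact not_not.2 he
      rw [if_pos he, if_neg this]
      constructor <;> linarith
    · have : Even (i + 1) := Int.even_add_one.2 he
      rw [if_neg he, if_pos this]
      constructor <;> linarith

lemma abs_tileT_sub_le {r : ℝ} (hr : 0 < r) {s t : ℝ} (h : |s - t| < 2 * r ^ 2) :
    |tileT r s - tileT r t| ≤ |s - t| := by
  rw [abs_lt] at h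
  rcases le_total s t with hst | hst
  · rw [abs_of_nonpos (sub_nonpos.2 hst), neg_sub]
    exact abs_tileT_sub_le_of_le hr hst (by linarith)
  · rw [abs_of_nonneg (sub_nonneg.2 hst), abs_sub_comm]
    exact abs_tileT_sub_le_of_le hr hst (by linarith)

lemma measurePreserving_fold (r : ℝ) (j : ℤ) : MeasurePreserving (fold r j) := by
  unfold fold
  by_cases h : Even j
  · simp only [h, if_true]
    exact measurePreserving_sub_right volume _
  · simp only [h, if_false]
    exact Measure.measurePreserving_sub_left volume _

lemma measurePreserving_prodMap_fold (r : ℝ) (j : ℤ) :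
    MeasurePreserving (fun p : E m × ℝ => (p.1, fold r j p.2)) :=
  (MeasurePreserving.id (volume : Measure (E m))).prod (measurePreserving_fold r j)

lemma lintegral_comp_tileT_le {r : ℝ} (hr : 0 < r) {H : E m × ℝ → ℝ≥0∞} (hH : Measurable H)
    {X : Set (E m)} {I J : Set ℝ} (hX : MeasurableSet X) (hI : MeasurableSet I)
    (hJ : MeasurableSet J) {j : ℤ} (hIj : I ⊆ piece r j) (hIJ : MapsTo (tileT r) I J) :
    ∫⁻ p in X ×ˢ I, H (p.1, tileT r p.2) ≤ ∫⁻ p in X ×ˢ J, H p := by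
  rw [← (measurePreserving_prodMap_fold r j).setLIntegral_comp_preimage (hX.prod hJ) hH]
  calc ∫⁻ p in X ×ˢ I, H (p.1, tileT r p.2) = ∫⁻ p in X ×ˢ I, H (p.1, fold r j p.2) :=
        setLIntegral_congr_fun (hX.prod hI) fun p hp => by
          simp only [tileT_eq_fold hr (hIj hp.2)]
    _ ≤ _ := by
        refine lintegral_mono_set fun p hp => ⟨hp.1, ?_⟩
        have := hIJ hp.2
        rwa [tileT_eq_fold hr (hIj hp.2)] at this

lemma ae_comp_tileT {r : ℝ} (hr : 0 < r) {P : E m × ℝ → Prop} (hP : ∀ᵐ p, P p) :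
    ∀ᵐ p : E m × ℝ, P (p.1, tileT r p.2) := by
  have : ∀ᵐ p : E m × ℝ, ∀ j : ℤ, P (p.1, fold r j p.2) :=
    ae_all_iff.2 fun j => (measurePreserving_prodMap_fold r j).quasiMeasurePreserving.ae hP
  filter_upwards [this] with p hp
  obtain ⟨j, hj⟩ := exists_mem_piece hr p.2
  rw [tileT_eq_fold hr hj]
  exact hp j

lemma measurableSet_piece (r : ℝ) (j : ℤ) : MeasurableSet (piece r j) := measurableSet_Ico

/-- Small cubes meet at most three time intervals of the tiling. -/
lemma lintegral_comp_tileT_pcube_le {r s : ℝ} (hs : 0 < s) (hsr : s ≤ r) (c : E m × ℝ)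
    {H : E m × ℝ → ℝ≥0∞} (hH : Measurable H) :
    ∫⁻ p in pcube c s, H (p.1, tileT r p.2) ≤ 3 * ∫⁻ p in pcube (c.1, tileT r c.2) s, H p := by
  have hr : 0 < r := hs.trans_le hsr
  have hsr2 : s ^ 2 ≤ r ^ 2 := by gcongr
  have hs2 : 0 < s ^ 2 := by positivity
  obtain ⟨i, hi⟩ := exists_mem_piece hr c.2
  let I := Ioo (c.2 - s ^ 2) (c.2 + s ^ 2)
  let J := Ioo (tileT r c.2 - s ^ 2) (tileT r c.2 + s ^ 2)
  let X := box c.1 s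
  have hX : MeasurableSet X := (isOpen_box _ _).measurableSet
  have hI : ∀ j, ∫⁻ p in X ×ˢ (I ∩ piece r j), H (p.1, tileT r p.2) ≤ ∫⁻ p in X ×ˢ J, H p := by
    intro j
    refine lintegral_comp_tileT_le hr hH hX (measurableSet_Ioo.inter (measurableSet_piece r j))
      measurableSet_Ioo inter_subset_right fun t ht => ?_
    have h1 : |t - c.2| < s ^ 2 := by
      rw [abs_lt]; constructor <;> linarith [ht.1.1, ht.1.2]
    have h2 := (abs_tileT_sub_le hr (s := t) (t := c.2) (by linarith)).trans_lt h1
    rw [abs_lt] at h2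
    constructor <;> linarith
  have hcov : pcube c s ⊆ (X ×ˢ (I ∩ piece r (i - 1)) ∪ X ×ˢ (I ∩ piece r i)) ∪
      X ×ˢ (I ∩ piece r (i + 1)) := by
    rw [pcube_eq_prod c hs]
    rintro p ⟨hp1, hp2⟩
    obtain ⟨j, hj⟩ := exists_mem_piece hr p.2
    have h1 := lt_add_one_of_mem_piece hr (n := 1) hj hi (by push_cast; linarith [hp2.2])
    have h2 := lt_add_one_of_mem_piece hr (n := 1) hi hj (by push_cast; linarith [hp2.1])
    obtain rfl | rfl | rfl : j = i - 1 ∨ j = i ∨ j = i + 1 := by omega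
    · exact Or.inl (Or.inl ⟨hp1, hp2, hj⟩)
    · exact Or.inl (Or.inr ⟨hp1, hp2, hj⟩)
    · exact Or.inr ⟨hp1, hp2, hj⟩
  rw [pcube_eq_prod (c.1, tileT r c.2) hs]
  calc ∫⁻ p in pcube c s, H (p.1, tileT r p.2)
      ≤ ((∫⁻ p in X ×ˢ (I ∩ piece r (i - 1)), H (p.1, tileT r p.2)) +
        (∫⁻ p in X ×ˢ (I ∩ piece r i), H (p.1, tileT r p.2))) +
        (∫⁻ p in X ×ˢ (I ∩ piece r (i + 1)), H (p.1, tileT r p.2)) :=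
        (lintegral_mono_set hcov).trans ((lintegral_union_le _ _ _).trans
          (add_le_add_left (lintegral_union_le _ _ _) _))
    _ ≤ ((∫⁻ p in X ×ˢ J, H p) + (∫⁻ p in X ×ˢ J, H p)) + (∫⁻ p in X ×ˢ J, H p) :=
        add_le_add (add_le_add (hI _) (hI _)) (hI _)
    _ = 3 * ∫⁻ p in X ×ˢ J, H p := by ring

/-- A half-open box of the grid of side length `2r`. -/
def gridBox (r : ℝ) (a : Fin m → ℤ) : Set (E m) :=
  {x | ∀ i, x i ∈ Ico (2 * r * a i) (2 * r * (a i + 1))}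

/-- The centre of a box of the grid. -/
def gridCenter (r : ℝ) (a : Fin m → ℤ) : E m := WithLp.toLp 2 fun i => r * (2 * a i + 1)

/-- A space-time cell of the tiling. -/
def cell (r : ℝ) (q : (Fin m → ℤ) × ℤ) : Set (E m × ℝ) := gridBox r q.1 ×ˢ piece r q.2

lemma measurableSet_gridBox (r : ℝ) (a : Fin m → ℤ) : MeasurableSet (gridBox r a) := by
  simp only [gridBox, ofPred_forall]
  refine MeasurableSet.iInter fun i => ?_
  have : Measurable fun x : E m => x i := by fun_prop
  exact this measurableSet_Ico

lemma volume_gridBox (r : ℝ) (a : Fin m → ℤ) :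
    volume (gridBox r a) = ENNReal.ofReal (2 * r) ^ m := by
  rw [gridBox, volume_pi_preimage _ fun i => measurableSet_Ico]
  simp only [Real.volume_Ico]
  rw [Finset.prod_congr rfl fun i _ => by
    rw [show 2 * r * ((a i : ℝ) + 1) - 2 * r * a i = 2 * r by ring]]
  simp

lemma box_subset_gridBox (r : ℝ) (a : Fin m → ℤ) : box (gridCenter r a) r ⊆ gridBox r a := by
  intro x hx i
  have := abs_lt.1 (hx i)
  simp only [gridCenter] at this
  constructor <;> linarith

lemma measurableSet_cell (r : ℝ) (q : (Fin m → ℤ) × ℤ) : MeasurableSet (cell r q) :=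
  (measurableSet_gridBox r q.1).prod (measurableSet_piece r q.2)

lemma volume_gridBox_prod {r : ℝ} (hr : 0 < r) (a : Fin m → ℤ) {I : Set ℝ}
    (hI : volume I = ENNReal.ofReal (2 * r ^ 2)) :
    volume (gridBox r a ×ˢ I) = volume (pcube (gridCenter r a, 0) r) := by
  rw [pcube_eq_prod _ hr, Measure.volume_eq_prod, Measure.prod_prod, Measure.prod_prod,
    volume_gridBox, volume_box, hI, Real.volume_Ioo]
  congr 2
  ring

lemma volume_cell {r : ℝ} (hr : 0 < r) (q : (Fin m → ℤ) × ℤ) :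
    volume (cell r q) = volume (pcube (gridCenter r q.1, 0) r) := by
  refine volume_gridBox_prod hr q.1 ?_
  rw [piece, Real.volume_Ico]
  congr 1
  ring

lemma lintegral_cell_comp_tileT_le {r : ℝ} (hr : 0 < r) {H : E m × ℝ → ℝ≥0∞} (hH : Measurable H)
    (q : (Fin m → ℤ) × ℤ) :
    ∫⁻ p in cell r q, H (p.1, tileT r p.2) ≤ ∫⁻ p in pcube (gridCenter r q.1, 0) r, H p := by
  refine (lintegral_comp_tileT_le hr hH (measurableSet_gridBox r q.1) (measurableSet_piece r q.2)
    (measurableSet_Icc (a := -r ^ 2) (b := r ^ 2)) subset_rfl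
    fun t _ => abs_le.1 (abs_tileT_le hr t)).trans_eq (setLIntegral_congr ?_)
  have hv : volume (gridBox r q.1 ×ˢ Icc (-r ^ 2) (r ^ 2))
      = volume (pcube (gridCenter r q.1, 0) r) := by
    refine volume_gridBox_prod hr q.1 ?_
    rw [Real.volume_Icc]
    congr 1
    ring
  refine (ae_eq_of_subset_of_measure_ge ?_ hv.le
    (measurableSet_pcube _ hr).nullMeasurableSet ?_).symm
  · rw [pcube_eq_prod _ hr]
    refine prod_mono (box_subset_gridBox r q.1) fun t ht => ?_
    simp only [zero_sub, zero_add] at ht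
    exact ⟨ht.1.le, ht.2.le⟩
  · rw [hv]
    exact volume_pcube_ne_top _ hr

lemma exists_mem_cell {r : ℝ} (hr : 0 < r) (p : E m × ℝ) : ∃ q, p ∈ cell r q := by
  obtain ⟨j, hj⟩ := exists_mem_piece hr p.2
  have h2r : 0 < 2 * r := by positivity
  refine ⟨(fun i => ⌊p.1 i / (2 * r)⌋, j), fun i => ⟨?_, ?_⟩, hj⟩
  · have := (le_div_iff₀ h2r).1 (Int.floor_le (p.1 i / (2 * r)))
    linarith
  · have := (div_lt_iff₀ h2r).1 (Int.lt_floor_add_one (p.1 i / (2 * r)))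
    linarith

lemma pairwise_disjoint_cell {r : ℝ} (hr : 0 < r) :
    Pairwise (Function.onFun Disjoint (cell (m := m) r)) := by
  intro q q' hne
  refine Set.disjoint_left.2 fun p hp hp' => hne ?_
  have h2r : 0 < 2 * r := by positivity
  refine Prod.ext (funext fun i => ?_) ?_
  · have key : ∀ b b' : ℤ, p.1 i ∈ Ico (2 * r * b) (2 * r * (b + 1)) →
        p.1 i ∈ Ico (2 * r * b') (2 * r * (b' + 1)) → b ≤ b' := by
      intro b b' h h'
      have h3 : (b : ℝ) < ((b' + 1 : ℤ) : ℝ) := by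
        push_cast
        exact lt_of_mul_lt_mul_left (h.1.trans_lt h'.2) h2r.le
      have := Int.cast_lt.1 h3
      omega
    exact le_antisymm (key _ _ (hp.1 i) (hp'.1 i)) (key _ _ (hp'.1 i) (hp.1 i))
  · have h1 := lt_add_one_of_mem_piece hr (n := 1) hp.2 hp'.2 (by simp; positivity)
    have h2 := lt_add_one_of_mem_piece hr (n := 1) hp'.2 hp.2 (by simp; positivity)
    have hr2 : 0 < r ^ 2 := by positivity
    have key : ∀ b b' : ℤ, p.2 ∈ piece r b → p.2 ∈ piece r b' → b ≤ b' := by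
      intro b b' h h'
      have h3 : ((2 * b - 1 : ℤ) : ℝ) < ((2 * b' + 1 : ℤ) : ℝ) := by
        push_cast
        exact lt_of_mul_lt_mul_right (h.1.trans_lt h'.2) hr2.le
      have := Int.cast_lt.1 h3
      omega
    exact le_antisymm (key _ _ hp.2 hp'.2) (key _ _ hp'.2 hp.2)

lemma setLIntegral_le_of_cover {α ι : Type*} [MeasurableSpace α] {μ : Measure α} [Countable ι]
    {A : ι → Set α} (hA : ∀ i, MeasurableSet (A i)) (hd : Pairwise (Function.onFun Disjoint A))
    {S T : Set α} (hS : S ⊆ ⋃ i, A i) (hT : ⋃ i, A i ⊆ T) {f : α → ℝ≥0∞} {M : ℝ≥0∞}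
    (hM : ∀ i, ∫⁻ p in A i, f p ∂μ ≤ M * μ (A i)) : ∫⁻ p in S, f p ∂μ ≤ M * μ T :=
  calc ∫⁻ p in S, f p ∂μ ≤ ∫⁻ p in ⋃ i, A i, f p ∂μ := lintegral_mono_set hS
    _ = ∑' i, ∫⁻ p in A i, f p ∂μ := lintegral_iUnion hA hd f
    _ ≤ ∑' i, M * μ (A i) := ENNReal.tsum_le_tsum hM
    _ = M * μ (⋃ i, A i) := by rw [ENNReal.tsum_mul_left, measure_iUnion hd hA]
    _ ≤ M * μ T := by gcongr

/-- A bound for the mean over the cells of the tiling gives a bound over all large cubes. -/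
lemma lintegral_pcube_le_of_cell {r s : ℝ} (hr : 0 < r) (hrs : r ≤ s) {f : E m × ℝ → ℝ≥0∞}
    {M : ℝ≥0∞} (hM : ∀ q, ∫⁻ p in cell r q, f p ≤ M * volume (cell r q)) (c : E m × ℝ) :
    ∫⁻ p in pcube c s, f p ≤ M * volume (pcube c (3 * s)) := by
  have hs : 0 < s := hr.trans_le hrs
  let ι := {q : (Fin m → ℤ) × ℤ // (cell r q ∩ pcube c s).Nonempty}
  have hdisj : Pairwise (Function.onFun Disjoint fun q : ι => cell r q.1) := fun q q' h =>
    pairwise_disjoint_cell hr fun e => h (Subtype.ext e)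
  have hcov : pcube c s ⊆ ⋃ q : ι, cell r q.1 := fun p hp => by
    obtain ⟨q, hq⟩ := exists_mem_cell hr p
    exact mem_iUnion.2 ⟨⟨q, p, hq, hp⟩, hq⟩
  have hsub : ⋃ q : ι, cell r q.1 ⊆ pcube c (3 * s) := by
    refine iUnion_subset fun q p hp => ?_
    obtain ⟨z, hz, hzc⟩ := q.2
    rw [mem_pcube_iff hs] at hzc
    rw [mem_pcube_iff (by positivity)]
    constructor
    · intro i
      have h1 := abs_lt.1 (hzc.1 i)
      have h2 := hz.1 i
      have h3 := hp.1 i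
      rw [abs_lt]
      constructor <;> linarith [h2.1, h2.2, h3.1, h3.2]
    · have h1 := abs_lt.1 hzc.2
      have h2 := hz.2
      have h3 := hp.2
      have h4 : r ^ 2 ≤ s ^ 2 := by gcongr
      rw [abs_lt]
      constructor <;> nlinarith [h2.1, h2.2, h3.1, h3.2]
  exact setLIntegral_le_of_cover (fun q : ι => measurableSet_cell r q.1) hdisj hcov hsub
    fun q => hM q.1

lemma setLIntegral_enorm_le_add {α V V' : Type*} [MeasurableSpace α] {μ : Measure α}
    [NormedAddCommGroup V] [NormedAddCommGroup V'] {f : α → V} {h : α → V'} {S : Set α}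
    (hS : MeasurableSet S) {a b : ℝ} (ha : 0 ≤ a) (hb : 0 ≤ b)
    (hf : ∫⁻ p in S, ‖f p‖ₑ ∂μ ≤ ENNReal.ofReal a * μ S) (hh : ∀ p ∈ S, ‖h p‖ ≤ ‖f p‖ + b) :
    ∫⁻ p in S, ‖h p‖ₑ ∂μ ≤ ENNReal.ofReal (a + b) * μ S :=
  calc ∫⁻ p in S, ‖h p‖ₑ ∂μ ≤ ∫⁻ p in S, (‖f p‖ₑ + ENNReal.ofReal b) ∂μ := by
        refine setLIntegral_mono' hS fun p hp => ?_
        rw [← ofReal_norm, ← ofReal_norm, ← ENNReal.ofReal_add (norm_nonneg _) hb]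
        exact ENNReal.ofReal_le_ofReal (hh p hp)
    _ = ∫⁻ p in S, ‖f p‖ₑ ∂μ + ENNReal.ofReal b * μ S := by
        rw [lintegral_add_right _ measurable_const, setLIntegral_const]
    _ ≤ ENNReal.ofReal (a + b) * μ S := by
        rw [ENNReal.ofReal_add ha hb, add_mul]
        gcongr

lemma BMOleOn.congr_ae {V : Type*} [NormedAddCommGroup V] [NormedSpace ℝ V]
    {f f' : E m × ℝ → V} {S : Set (E m × ℝ)} {B : ℝ} (h : BMOleOn f S B)
    (hff' : f =ᵐ[volume.restrict S] f') : BMOleOn f' S B := by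
  intro c s hs hc
  have h1 : f =ᵐ[volume.restrict (pcube c s)] f' := ae_mono (Measure.restrict_mono_set _ hc) hff'
  have h2 := h c s hs hc
  rw [average_congr h1] at h2
  have h3 : (fun p => ‖f p - ⨍ q in pcube c s, f' q‖)
      =ᵐ[volume.restrict (pcube c s)] fun p => ‖f' p - ⨍ q in pcube c s, f' q‖ :=
    h1.mono fun p hp => by simp only [hp]
  rwa [average_congr h3] at h2

/-- The mean oscillation bound for the glued gradient, in terms of a bounded error term `W`. -/
lemma bmo_glued {G W : E m × ℝ → E m} {ρ : E m → ℝ} {η r R ℓ C₀ M : ℝ} {k : ℕ}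
    (hC₀ : 0 < C₀) (hη : 0 < η) (hr : 0 < r) (hℓ : 0 ≤ ℓ) (hR : R = 2 ^ k * r) (hrη : r ≤ R * η)
    (hG : Measurable G) (hGℓ : ∀ p, ‖G p‖ ≤ ℓ) (hB : BMOleOn G (pcube 0 (2 * R)) (C₀ * η))
    (hW : Measurable W) (hWM : ∀ p, ‖W p‖ ≤ M) (hρm : Measurable ρ)
    (hρ01 : ∀ x, 0 ≤ ρ x ∧ ρ x ≤ 1) (hρ0 : ∀ x : E m, (∃ i, 2 * R ≤ |x i|) → ρ x = 0)
    (hρL : ∀ x y, |ρ x - ρ y| ≤ C₀ / R * ‖x - y‖) :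
    BMOleOn (fun p : E m × ℝ => ρ p.1 • G (p.1, tileT r p.2) + W p
      + (1 - ρ p.1) • (⨍ q in pcube 0 r, G q)) univ
      (2 * (M + 3 ^ (m + 2) * (3 * 2 ^ (m + 2) * C₀ * ((k + 1) * η)) + 4 * C₀ * m * (η * ℓ)
        + 3 * C₀ * ((k + 1) * η))) := by
  have hRr : r ≤ R := by
    rw [hR]
    have : (1 : ℝ) ≤ 2 ^ k := one_le_pow₀ (by norm_num)
    nlinarith
  have hR0 : 0 < R := hr.trans_le hRr
  have h2R : 0 < 2 * R := by positivity
  have hM : 0 ≤ M := (norm_nonneg _).trans (hWM 0)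
  have hGi : ∀ c' s, 0 < s → IntegrableOn G (pcube c' s) := fun c' s hs =>
    integrableOn_pcube_of_bounded hs hG.aestronglyMeasurable hGℓ
  set c := ⨍ q in pcube 0 r, G q with hc
  have hcℓ : ‖c‖ ≤ ℓ := by
    rw [hc, setAverage_pcube _ _ hr, norm_smul, Real.norm_eq_abs,
      abs_of_pos (inv_pos.2 (cubeVol_pos hr)), inv_mul_le_iff₀ (cubeVol_pos hr), mul_comm]
    have := norm_setIntegral_le_of_norm_le_const (μ := volume) (f := G)
      (volume_pcube_ne_top (0 : E m × ℝ) hr).lt_top fun p _ => hGℓ p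
    rwa [volumeReal_pcube _ hr] at this
  have hGc : ∀ p, ‖G p - c‖ ≤ 2 * ℓ := fun p => (norm_sub_le _ _).trans (by linarith [hGℓ p])
  set L := ((k : ℝ) + 1) * η with hL
  have hηL : η ≤ L := by
    rw [hL]
    nlinarith [mul_nonneg (Nat.cast_nonneg (α := ℝ) k) hη.le]
  have hL0 : 0 ≤ L := hη.le.trans hηL
  let T : E m × ℝ → E m × ℝ := fun p => (p.1, tileT r p.2)
  have hT : Measurable T := measurable_fst.prodMk ((measurable_tileT r).comp measurable_snd)
  set F : E m × ℝ → E m := fun p => ρ p.1 • G (p.1, tileT r p.2) + W p + (1 - ρ p.1) • c with hF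
  have hFm : Measurable F := by
    have h1 : Measurable fun p : E m × ℝ => ρ p.1 := hρm.comp measurable_fst
    exact ((h1.smul (hG.comp hT)).add hW).add ((measurable_const.sub h1).smul measurable_const)
  have hFc : ∀ p, F p - c = ρ p.1 • (G (T p) - c) + W p := by
    intro p
    simp only [hF, T]
    module
  have hρn : ∀ x, ‖ρ x‖ ≤ 1 := fun x => by
    rw [Real.norm_eq_abs, abs_of_nonneg (hρ01 x).1]
    exact (hρ01 x).2
  have hFb : ∀ p, ‖F p‖ ≤ 3 * ℓ + M := by
    intro p
    have h1 : ‖ρ p.1 • (G (T p) - c)‖ ≤ 2 * ℓ := by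
      rw [norm_smul]
      nlinarith [hρn p.1, hGc (T p), norm_nonneg (ρ p.1), norm_nonneg (G (T p) - c)]
    have h2 : F p = (ρ p.1 • (G (T p) - c) + W p) + c := by rw [← hFc, sub_add_cancel]
    rw [h2]
    have h3 := norm_add_le (ρ p.1 • (G (T p) - c) + W p) c
    have h4 := norm_add_le (ρ p.1 • (G (T p) - c)) (W p)
    linarith [hWM p]
  intro z s hs _
  have hFi : IntegrableOn F (pcube z s) :=
    integrableOn_pcube_of_bounded hs hFm.aestronglyMeasurable hFb
  have hS := measurableSet_pcube z hs
  have hp1 : 0 ≤ 3 ^ (m + 2) * (3 * 2 ^ (m + 2) * C₀ * L) := by positivity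
  have hp2 : 0 ≤ 4 * C₀ * m * (η * ℓ) := by positivity
  have hp3 : 0 ≤ 3 * C₀ * L := by positivity
  suffices h : ∃ A : E m, ∃ b, 0 ≤ b ∧ b ≤ M + 3 ^ (m + 2) * (3 * 2 ^ (m + 2) * C₀ * L)
      + 4 * C₀ * m * (η * ℓ) + 3 * C₀ * L ∧
      ∫⁻ p in pcube z s, ‖F p - A‖ₑ ≤ ENNReal.ofReal b * volume (pcube z s) by
    obtain ⟨A, b, hb0, hb, hA⟩ := h
    exact (oscillation_le_of_lintegral hs hb0 hFi A hA).trans (by linarith)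
  rcases le_or_gt r s with hrs | hsr
  · -- large cubes are covered by cells
    refine ⟨c, 3 * 2 ^ (m + 2) * C₀ * L * 3 ^ (m + 2) + M, by positivity, by linarith, ?_⟩
    refine setLIntegral_enorm_le_add (f := fun p => ρ p.1 • (G (T p) - c)) hS (by positivity) hM
      ?_ fun p _ => ?_
    · have hcell : ∀ q, ∫⁻ p in cell r q, ‖ρ p.1 • (G (T p) - c)‖ₑ
          ≤ ENNReal.ofReal (3 * 2 ^ (m + 2) * C₀ * L) * volume (cell r q) := by
        intro q
        by_cases hq : ∀ i, -2 ^ k ≤ q.1 i ∧ q.1 i < 2 ^ k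
        · have hctr : ∀ i, |gridCenter r q.1 i| ≤ 2 * R - r := by
            intro i
            obtain ⟨h1, h2⟩ := hq i
            have h1' : -(2 : ℝ) ^ k ≤ q.1 i := by exact_mod_cast h1
            have h2' : (q.1 i : ℝ) + 1 ≤ 2 ^ k := by exact_mod_cast h2
            simp only [gridCenter, hR, abs_le]
            constructor <;> nlinarith
          have hsub : pcube (gridCenter r q.1, 0) r ⊆ pcube 0 (2 * R) := by
            refine pcube_subset_pcube hr h2R (fun i => ?_) ?_
            · simpa using hctr i
            · simp only [Prod.snd_zero, sub_self, abs_zero]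
              nlinarith
          set a := ⨍ p in pcube (gridCenter r q.1, 0) r, G p with ha
          have hac : ‖a - c‖ ≤ 2 * (2 ^ (m + 2) * C₀ * L) := by
            have h1 := average_chain hr hR (hGi 0 _ h2R) hB hctr
            have h2 := average_chain hr hR (hGi 0 _ h2R) hB (x := 0)
              (fun i => by simp; linarith)
            rw [norm_sub_rev] at h2
            rw [← Prod.zero_eq_mk, ← hc] at h2
            rw [← ha] at h1
            have h3 := norm_sub_le_norm_sub_add_norm_sub a (⨍ p in pcube 0 (2 * R), G p) c
            rw [hL]
            linarith
          have h1 := lintegral_enorm_sub_le_of_average hr (hGi _ r hr) a (hB _ _ hr hsub)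
          have h2 := setLIntegral_enorm_le_add (h := fun p => G p - c)
            (measurableSet_pcube _ hr) (by positivity) (by positivity) h1
            (fun p _ => (norm_sub_le_norm_sub_add_norm_sub (G p) a c).trans
              (add_le_add_right hac _))
          rw [volume_cell hr]
          calc ∫⁻ p in cell r q, ‖ρ p.1 • (G (T p) - c)‖ₑ
              ≤ ∫⁻ p in cell r q, ‖G (T p) - c‖ₑ := by
                refine lintegral_mono fun p => ?_
                rw [enorm_le_iff_norm_le, norm_smul]
                exact mul_le_of_le_one_left (norm_nonneg _) (hρn _)
            _ ≤ _ := lintegral_cell_comp_tileT_le hr (H := fun p => ‖G p - c‖ₑ)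
                (hG.sub_const c).enorm q
            _ ≤ _ := h2
            _ ≤ _ := by
                gcongr
                have : C₀ * η ≤ 2 ^ (m + 2) * C₀ * L := by
                  have : (1 : ℝ) ≤ 2 ^ (m + 2) := one_le_pow₀ (by norm_num)
                  calc C₀ * η ≤ C₀ * L := by gcongr
                    _ ≤ 2 ^ (m + 2) * (C₀ * L) := le_mul_of_one_le_left (by positivity) this
                    _ = _ := by ring
                linarith
        · have h0 : ∫⁻ p in cell r q, ‖ρ p.1 • (G (T p) - c)‖ₑ = 0 := by
            rw [setLIntegral_congr_fun (g := fun _ => 0) (measurableSet_cell r q) ?_]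
            · simp
            · intro p hp
              push Not at hq
              obtain ⟨i, hi⟩ := hq
              have : ρ p.1 = 0 := by
                refine hρ0 _ ⟨i, ?_⟩
                have h1 := hp.1 i
                rw [le_abs, hR]
                rcases lt_or_ge (q.1 i) (-2 ^ k) with hlt | hge
                · right
                  have : (q.1 i : ℝ) + 1 ≤ -2 ^ k := by exact_mod_cast hlt
                  nlinarith [h1.2]
                · left
                  have : (2 : ℝ) ^ k ≤ q.1 i := by exact_mod_cast hi hge
                  nlinarith [h1.1]
              simp [this]
          rw [h0]
          exact zero_le
      refine (lintegral_pcube_le_of_cell hr hrs hcell z).trans_eq ?_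
      rw [volume_pcube _ (by positivity), volume_pcube _ hs, cubeVol_mul,
        ← ENNReal.ofReal_mul (by positivity), ← ENNReal.ofReal_mul (by positivity)]
      congr 1
      ring
    · rw [hFc]
      exact (norm_add_le _ _).trans (add_le_add_right (hWM p) _)
  · have hρs : ∀ x y : E m, (∀ i, |x i - y i| ≤ 2 * s) →
        |ρ x - ρ y| ≤ 2 * C₀ * m * η := by
      intro x y hxy
      have h1 : ‖x - y‖ ≤ m * (2 * s) := norm_le_of_coord_le (by positivity) hxy
      calc |ρ x - ρ y| ≤ C₀ / R * (m * (2 * s)) := (hρL x y).trans (by gcongr)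
        _ = 2 * C₀ * m * (s / R) := by ring
        _ ≤ 2 * C₀ * m * η := by
            gcongr
            rw [div_le_iff₀ hR0]
            linarith
    have hprod : ∀ (t : ℝ) (p), |t| ≤ 2 * C₀ * m * η →
        ‖t • (G p - c)‖ ≤ 4 * C₀ * m * (η * ℓ) := by
      intro t p ht
      rw [norm_smul, Real.norm_eq_abs]
      calc |t| * ‖G p - c‖ ≤ (2 * C₀ * m * η) * (2 * ℓ) := by
            gcongr
            exact hGc p
        _ = _ := by ring
    have hcoord : ∀ p ∈ pcube z s, ∀ p' ∈ pcube z s, ∀ i, |p.1 i - p'.1 i| ≤ 2 * s := by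
      intro p hp p' hp' i
      have h1 := abs_lt.1 (hp.1 i)
      have h2 := abs_lt.1 (hp'.1 i)
      rw [abs_le]
      constructor <;> linarith
    by_cases hbd : ∃ p ∈ pcube z s, ∃ i, 2 * R ≤ |p.1 i|
    · -- small cubes touching the lateral boundary
      obtain ⟨p', hp', hi⟩ := hbd
      have hρp' := hρ0 p'.1 hi
      refine ⟨c, 0 + (M + 4 * C₀ * m * (η * ℓ)), by positivity, by linarith, ?_⟩
      refine setLIntegral_enorm_le_add (f := fun _ => (0 : ℝ)) hS le_rfl (by positivity)
        (by simp) fun p hp => ?_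
      have h1 := hρs p.1 p'.1 (hcoord p hp p' hp')
      rw [hρp', sub_zero] at h1
      have h2 := hprod _ (T p) h1
      rw [hFc, norm_zero, zero_add]
      exact (norm_add_le _ _).trans (by linarith [hWM p])
    · -- small cubes inside the slab
      push Not at hbd
      have hzz : z ∈ pcube z s := by simp [mem_pcube_iff hs, hs]
      set z' : E m × ℝ := (z.1, tileT r z.2) with hz'
      have hsub : pcube z' s ⊆ pcube 0 (2 * R) := by
        intro p hp
        rw [mem_pcube_iff hs] at hp
        rw [mem_pcube_iff h2R]
        constructor
        · intro i
          have : (p.1, z.2) ∈ pcube z s := by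
            rw [mem_pcube_iff hs]
            exact ⟨hp.1, by simp only [sub_self, abs_zero]; positivity⟩
          simpa using hbd _ this i
        · have h1 := abs_lt.1 hp.2
          have h2 := abs_le.1 (abs_tileT_le hr z.2)
          have h3 : s ^ 2 < r ^ 2 := by gcongr
          have h4 : r ^ 2 ≤ R ^ 2 := by gcongr
          simp only [hz'] at h1
          simp only [Prod.snd_zero, sub_zero, abs_lt]
          constructor <;> nlinarith
      set a := ⨍ p in pcube z' s, G p with ha
      have h1 := lintegral_enorm_sub_le_of_average hs (hGi _ s hs) a (hB _ _ hs hsub)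
      refine ⟨c + ρ z.1 • (a - c), 3 * (C₀ * η) + (M + 4 * C₀ * m * (η * ℓ)), by positivity, ?_, ?_⟩
      · have : C₀ * η ≤ C₀ * L := by gcongr
        linarith
      refine setLIntegral_enorm_le_add (f := fun p => G (T p) - a) hS (by positivity)
        (by positivity) ?_ fun p hp => ?_
      · refine (lintegral_comp_tileT_pcube_le hs hsr.le z (H := fun p => ‖G p - a‖ₑ)
          (hG.sub_const a).enorm).trans ?_
        refine (mul_le_mul_right h1 3).trans_eq ?_
        rw [volume_pcube _ hs, volume_pcube _ hs, ENNReal.ofReal_mul (p := 3) (by norm_num),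
          mul_assoc]
        norm_num
      · have e : F p - (c + ρ z.1 • (a - c))
            = ρ z.1 • (G (T p) - a) + (W p + (ρ p.1 - ρ z.1) • (G (T p) - c)) := by
          rw [← sub_sub, hFc]
          module
        have h2 := hprod _ (T p) (hρs p.1 z.1 (hcoord p hp z hzz))
        have h3 : ‖ρ z.1 • (G (T p) - a)‖ ≤ ‖G (T p) - a‖ := by
          rw [norm_smul]
          exact mul_le_of_le_one_left (norm_nonneg _) (hρn _)
        rw [e]
        refine (norm_add_le _ _).trans (add_le_add h3 ?_)
        exact (norm_add_le _ _).trans (add_le_add (hWM p) h2)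

/-- The number of dyadic scales between `1` and `2/η` is at most a multiple of `η^(-ε)`. -/
lemma mul_le_rpow_of_two_pow_lt {k : ℕ} {η ε : ℝ} (hη : 0 < η) (hη1 : η < 1) (hε : 0 < ε)
    (hε1 : ε < 1) (h : 2 ^ k * η < 2) :
    ((k : ℝ) + 1) * η ≤ (1 + 2 / (ε * Real.log 2)) * η ^ (1 - ε) := by
  have hlog : 0 < Real.log 2 := Real.log_pos (by norm_num)
  have hηε : 0 < η ^ (-ε) := Real.rpow_pos_of_pos hη _
  have h1 : (1 : ℝ) ≤ η ^ (-ε) := Real.one_le_rpow_of_pos_of_le_one_of_nonpos hη hη1.le (by linarith)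
  have h2 : (k : ℝ) * (ε * Real.log 2) ≤ 2 * η ^ (-ε) := by
    calc (k : ℝ) * (ε * Real.log 2) ≤ Real.exp (k * (ε * Real.log 2)) := by
          linarith [Real.add_one_le_exp ((k : ℝ) * (ε * Real.log 2))]
      _ = ((2 : ℝ) ^ k) ^ ε := by
          rw [← Real.rpow_natCast, ← Real.rpow_mul (by norm_num),
            Real.rpow_def_of_pos (by norm_num)]
          congr 1
          ring
      _ ≤ (2 / η) ^ ε := by
          refine Real.rpow_le_rpow (by positivity) ?_ hε.le
          rw [le_div_iff₀ hη]
          exact h.le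
      _ = 2 ^ ε * η ^ (-ε) := by
          rw [Real.div_rpow (by norm_num) hη.le, Real.rpow_neg hη.le, div_eq_mul_inv]
      _ ≤ 2 * η ^ (-ε) := by
          gcongr
          calc (2 : ℝ) ^ ε ≤ 2 ^ (1 : ℝ) := Real.rpow_le_rpow_of_exponent_le (by norm_num) hε1.le
            _ = 2 := Real.rpow_one 2
  have h3 : (k : ℝ) ≤ 2 / (ε * Real.log 2) * η ^ (-ε) := by
    rw [div_mul_eq_mul_div, le_div_iff₀ (by positivity)]
    exact h2
  have h4 : η ^ (1 - ε) = η ^ (-ε) * η := by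
    rw [show 1 - ε = -ε + 1 by ring, Real.rpow_add hη, Real.rpow_one]
  rw [h4, ← mul_assoc]
  gcongr
  linarith

lemma eq_zero_of_le_abs {ρ : E m → ℝ} (hρ : Continuous ρ) {a : ℝ} (ha : 0 < a)
    (h0 : ∀ x : E m, (∃ i, a < |x i|) → ρ x = 0) {x : E m} (hx : ∃ i, a ≤ |x i|) : ρ x = 0 := by
  obtain ⟨i, hi⟩ := hx
  have h1 : Filter.Tendsto (fun t : ℝ => ρ (t • x)) (nhdsWithin 1 (Ioi 1)) (nhds (ρ x)) := by
    have : Continuous fun t : ℝ => ρ (t • x) := by fun_prop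
    simpa using (this.tendsto 1).mono_left nhdsWithin_le_nhds
  refine tendsto_nhds_unique h1 (tendsto_const_nhds.congr' ?_)
  filter_upwards [self_mem_nhdsWithin] with t ht
  refine (h0 _ ⟨i, ?_⟩).symm
  have ht' : (1 : ℝ) < t := ht
  rw [PiLp.smul_apply, smul_eq_mul, abs_mul, abs_of_pos (by linarith : (0 : ℝ) < t)]
  nlinarith

lemma gradient_eq_zero_of_eq_zero {ρ : E m → ℝ} (hρ : ∀ x, 0 ≤ ρ x) {x v : E m} (hx : ρ x = 0)
    (hv : HasGradientAt ρ v x) : v = 0 := by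
  have hmin : IsLocalMin ρ x := Filter.Eventually.of_forall fun y => by rw [hx]; exact hρ y
  have := hmin.hasFDerivAt_eq_zero hv.hasFDerivAt
  simpa using this

lemma abs_sub_le_of_norm_gradient_le {ρ : E m → ℝ} {v : E m → E m} {K : ℝ}
    (hv : ∀ x, HasGradientAt ρ (v x) x) (hK : ∀ x, ‖v x‖ ≤ K) (x y : E m) :
    |ρ x - ρ y| ≤ K * ‖x - y‖ :=
  convex_univ.norm_image_sub_le_of_norm_hasFDerivWithin_le
    (fun x _ => (hv x).hasFDerivAt.hasFDerivWithinAt) (fun x _ => by simpa using hK x)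
    (mem_univ y) (mem_univ x)

lemma measurable_gradient {ρ : E m → ℝ} {v : E m → E m} (hρ : ContDiff ℝ (⊤ : ℕ∞) ρ)
    (hv : ∀ x, HasGradientAt ρ (v x) x) : Measurable v := by
  have : v = fun x => (InnerProductSpace.toDual ℝ (E m)).symm (fderiv ℝ ρ x) := by
    ext1 x
    rw [(hv x).hasFDerivAt.fderiv, LinearIsometryEquiv.symm_apply_apply]
  rw [this]
  exact ((LinearIsometryEquiv.continuous _).comp (hρ.continuous_fderiv (by simp))).measurable

lemma tileT_eq_self {r t : ℝ} (hr : 0 < r) (ht : |t| < r ^ 2) : tileT r t = t := by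
  rw [abs_lt] at ht
  rw [tileT_eq_fold hr (j := 0) ⟨by simpa using ht.1.le, by simpa using ht.2⟩]
  simp [fold]

end Par

/-- cf. Lemma `L:BMO:ext:nabla`: with
`Φ = φ̃ρ + (1−ρ)(x·(∇φ̃)_{Q_r})` built from the reflected–tiled extension `φ̃`
and a smooth cutoff `ρ`, and with `‖∇φ‖_{*,Q_{2R}} ≤ C₀η`, the gradient
`∇Φ = ρ∇φ̃ + (φ̃ − x·(∇φ̃)_{Q_r})∇ρ + (1−ρ)(∇φ̃)_{Q_r}` lies in parabolic
`BMO(ℝⁿ)` with `‖∇Φ‖_* ≤ C_ε (η^{1−ε} + ηℓ)` for every `0 < ε < 1`. -/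
theorem stmt8 (m : ℕ) (hm : 1 ≤ m) (C₀ ε : ℝ) (hC₀ : 0 < C₀)
    (hε : 0 < ε) (hε1 : ε < 1) :
    ∃ Cε : ℝ, 0 < Cε ∧
      ∀ (η r R ℓ : ℝ) (k : ℕ) (φ : E m × ℝ → ℝ) (g : E m × ℝ → E m)
        (ρ : E m → ℝ) (gρ : E m → E m),
        0 < η → η < 1 → 0 < r → 0 ≤ ℓ →
        R = 2 ^ k * r → R * η / 2 < r → r ≤ R * η →
        LipPar φ ℓ (pcube 0 (2 * R)) → φ 0 = 0 →
        IsSpatialGradientOn φ g (pcube 0 (2 * R)) →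
        BMOleOn g (pcube 0 (2 * R)) (C₀ * η) →
        -- the cutoff function ρ and its gradient
        ContDiff ℝ (⊤ : ℕ∞) ρ →
        (∀ x, 0 ≤ ρ x ∧ ρ x ≤ 1) →
        (∀ x : E m, (∀ i, |x i| < r) → ρ x = 1) →
        (∀ x : E m, (∃ i, 2 * R < |x i|) → ρ x = 0) →
        (∀ x, HasGradientAt ρ (gρ x) x) →
        (∀ x, ‖gρ x‖ ≤ C₀ / R) →
        (∀ x, ‖fderiv ℝ gρ x‖ ≤ C₀ / R ^ 2) →
        BMOleOn (fun p : E m × ℝ =>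
            ρ p.1 • tRefV r g p
            + (tRef r φ p -
                inner (𝕜 := ℝ) p.1 (⨍ q in pcube 0 r, tRefV r g q)) • gρ p.1
            + (1 - ρ p.1) • (⨍ q in pcube 0 r, tRefV r g q))
          Set.univ (Cε * (η ^ (1 - ε) + η * ℓ)) := by
  set Λ : ℝ := 1 + 2 / (ε * Real.log 2) with hΛ
  have hΛ0 : 0 < Λ := by
    have := Real.log_pos (show (1 : ℝ) < 2 by norm_num)
    positivity
  set A : ℝ := 2 * (C₀ * (8 * m + 3)) with hA
  set D : ℝ := 2 * (4 * m * 2 ^ (m + 2) * C₀ ^ 2 + 3 ^ (m + 2) * (3 * 2 ^ (m + 2) * C₀) + 3 * C₀)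
    with hD
  have hA0 : 0 < A := by positivity
  have hD0 : 0 < D := by positivity
  refine ⟨A + D * Λ, by positivity, ?_⟩
  intro η r R ℓ k φ g ρ gρ hη hη1 hr hℓ hR hηr hrη hφ hφ0 hg hB hρs hρ01 _ hρ0 hgρ hgρK _
  have hRr : r ≤ R := by
    rw [hR]
    exact le_mul_of_one_le_left hr.le (one_le_pow₀ (by norm_num))
  have hR0 : 0 < R := hr.trans_le hRr
  have h2R : 0 < 2 * R := by positivity
  have hk : 2 ^ k * η < 2 := by
    rw [hR] at hηr
    have : 2 ^ k * η * r < 2 * r := by linarith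
    exact lt_of_mul_lt_mul_right this hr.le
  set L : ℝ := (k + 1) * η with hL
  have hL0 : 0 ≤ L := by positivity
  have hLΛ : L ≤ Λ * η ^ (1 - ε) := mul_le_rpow_of_two_pow_lt hη hη1 hε hε1 hk
  have hS : IsOpen (pcube (0 : E m × ℝ) (2 * R)) := isOpen_pcube _ h2R
  obtain ⟨G, hG, hGℓ, hgG⟩ := hg.exists_measurable hφ hℓ hS
  have hGφ : IsSpatialGradientOn φ G (pcube 0 (2 * R)) := by
    filter_upwards [hg, hgG] with p h1 h2
    rwa [← h2]
  have hGB : BMOleOn G (pcube 0 (2 * R)) (C₀ * η) := hB.congr_ae hgG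
  have hρ0' : ∀ x : E m, (∃ i, 2 * R ≤ |x i|) → ρ x = 0 := fun x hx =>
    eq_zero_of_le_abs hρs.continuous h2R hρ0 hx
  have hgρ0 : ∀ x : E m, (∃ i, 2 * R ≤ |x i|) → gρ x = 0 := fun x hx =>
    gradient_eq_zero_of_eq_zero (fun y => (hρ01 y).1) (hρ0' x hx) (hgρ x)
  have hmem : ∀ p : E m × ℝ, (∀ i, |p.1 i| < 2 * R) → (p.1, tileT r p.2) ∈ pcube 0 (2 * R) := by
    intro p hp
    rw [mem_pcube_iff h2R]
    refine ⟨by simpa using hp, ?_⟩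
    have h1 := abs_tileT_le hr p.2
    simp only [Prod.snd_zero, sub_zero]
    nlinarith
  set c := ⨍ q in pcube 0 r, G q with hc
  have hcg : ⨍ q in pcube 0 r, tRefV r g q = c := by
    refine average_congr ?_
    have hsub : pcube (0 : E m × ℝ) r ⊆ pcube 0 (2 * R) :=
      pcube_subset_pcube hr h2R (fun i => by simp; linarith) (by simp; nlinarith)
    filter_upwards [ae_mono (Measure.restrict_mono_set _ hsub) hgG,
      ae_restrict_mem (measurableSet_pcube _ hr)] with p h1 h2
    rw [mem_pcube_iff hr] at h2
    rw [tRefV, tileT_eq_self hr (by simpa using h2.2)]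
    exact h1
  set W : E m × ℝ → E m := fun p =>
    ((pcube 0 (2 * R)).indicator φ (p.1, tileT r p.2) - inner (𝕜 := ℝ) p.1 c) • gρ p.1 with hW
  have hWm : Measurable W := by
    have h1 := (hφ.measurable_indicator hS.measurableSet).comp
      (measurable_fst.prodMk ((measurable_tileT r).comp measurable_snd))
    have h2 : Measurable fun p : E m × ℝ => inner (𝕜 := ℝ) p.1 c :=
      (by fun_prop : Continuous fun p : E m × ℝ => inner (𝕜 := ℝ) p.1 c).measurable
    exact (h1.sub h2).smul ((measurable_gradient hρs hgρ).comp measurable_fst)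
  set M : ℝ := C₀ * ((4 * m + 3) * (η * ℓ) + 4 * m * 2 ^ (m + 2) * C₀ * L) with hM
  have hM0 : 0 ≤ M := by positivity
  have hWM : ∀ p, ‖W p‖ ≤ M := by
    intro p
    by_cases hp : ∀ i, |p.1 i| < 2 * R
    · have h1 := abs_sub_inner_le hr hR hℓ hφ hφ0 hG hGℓ hGφ (by positivity) hGB hp
        (abs_tileT_le hr p.2)
      simp only [hW]
      rw [indicator_of_mem (hmem p hp), norm_smul, Real.norm_eq_abs]
      refine (mul_le_mul h1 (hgρK p.1) (norm_nonneg _) (by positivity)).trans ?_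
      have h2 : r / R ≤ η := by
        rw [div_le_iff₀ hR0]
        linarith
      calc _ = C₀ * ((4 * m + 3) * (r / R * ℓ)
            + 4 * m * 2 ^ (m + 2) * C₀ * ((k + 1) * η) * (R / R)) := by ring
        _ ≤ M := by
            rw [div_self hR0.ne', mul_one, hM]
            gcongr
    · push Not at hp
      simpa [hW, hgρ0 _ hp] using hM0
  have hglue := bmo_glued hC₀ hη hr hℓ hR hrη hG hGℓ hGB hWm hWM hρs.continuous.measurable
    hρ01 hρ0' (abs_sub_le_of_norm_gradient_le hgρ hgρK)
  have hae : ∀ᵐ p : E m × ℝ, p ∈ pcube 0 (2 * R) → g p = G p :=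
    (ae_restrict_iff' hS.measurableSet).1 hgG
  have hfin := hglue.congr_ae (f' := fun p : E m × ℝ =>
      ρ p.1 • tRefV r g p
      + (tRef r φ p - inner (𝕜 := ℝ) p.1 (⨍ q in pcube 0 r, tRefV r g q)) • gρ p.1
      + (1 - ρ p.1) • (⨍ q in pcube 0 r, tRefV r g q)) (by
    rw [Measure.restrict_univ]
    filter_upwards [ae_comp_tileT hr hae] with p h
    rw [hcg]
    by_cases hp : ∀ i, |p.1 i| < 2 * R
    · have h1 := hmem p hp
      simp only [hW, tRefV, tRef, indicator_of_mem h1, h h1]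
      rfl
    · push Not at hp
      simp only [hW, hρ0' _ hp, hgρ0 _ hp, zero_smul, smul_zero]
      rfl)
  intro z s hs hz
  refine (hfin z s hs hz).trans ?_
  have hx : 0 ≤ η ^ (1 - ε) := Real.rpow_nonneg hη.le _
  calc _ = A * (η * ℓ) + D * L := by
        rw [hM, hA, hD]
        ring
    _ ≤ A * (η * ℓ) + D * (Λ * η ^ (1 - ε)) := by gcongr
    _ ≤ (A + D * Λ) * (η ^ (1 - ε) + η * ℓ) := by
        have h1 : 0 ≤ A * η ^ (1 - ε) := by positivity
        have h2 : 0 ≤ D * Λ * (η * ℓ) := by positivity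
        linarith
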